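/- For every y > 0, the μ-measure of the set of x ∈ (0,1) whose first N spliced continued fraction digits satisfy max_{1 ≤ n ≤ N} a_n(x) ≤ 2Ny/log(2+√3) converges, as N → ∞, to exp(−1/y). -/

import Mathlib

open MeasureTheory Real Set Filter Topology

namespace SCF

/-- The involution `ι(x) = (1−x)/(1+x)`. -/
noncomputable def iota (x : ℝ) : ℝ := (1 - x) / (1 + x)

/-- Even continued-fraction step.  For `y ∈ (0,1/2]` one has
`⌊(1/y+1)/2⌋ = k` whenever `1/y ∈ (2k−1, 2k+1)`, so `Te y = |1/y − 2k|`;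
explicitly `Te y = 1/y − 2` on `[1/3,1/2]`, `Te y = 1/y − 2k` on
`[1/(2k+1), 1/(2k))` and `Te y = 2k − 1/y` on `[1/(2k), 1/(2k−1))` (`k ≥ 2`). -/
noncomputable def Te (y : ℝ) : ℝ := |1 / y - 2 * (⌊(1 / y + 1) / 2⌋ : ℝ)|

/-- The spliced continued fraction (SCF) map `T : [0,1] → [0,1]`, with
`T 0 = 0`, `T 1 = 1`.  On `(0,1/2]` it is the even continued fraction map
(see `Te`), and on `(1/2,1)` it is the odd–odd map, which is the conjugate
`ι ∘ Te ∘ ι` of the even map; this agrees with the branchwise definition: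
`T x = (k x − (k−1))/(k − (k+1) x)` on `((k−1)/k, (2k−1)/(2k+1)]` and
`T x = (k − (k+1) x)/(k x − (k−1))` on `((2k−1)/(2k+1), k/(k+1)]` for `k ≥ 2`. -/
noncomputable def T (x : ℝ) : ℝ :=
  if x ≤ 0 then 0
  else if 1 ≤ x then 1
  else if x ≤ 1 / 2 then Te x
  else iota (Te (iota x))

/-- Parity label of a digit: `e` (even cusp) or `o` (odd–odd cusp). -/
inductive Par | e | o
deriving DecidableEq

/-- A candidate SCF digit `(a, ε)_s`. -/
structure Digit where
  a : ℤ
  eps : ℤ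
  s : Par
deriving DecidableEq

/-- The digit set `𝒜 = {(k,ε)_s : k ≥ 2, ε = ±1, s ∈ {e,o}} ∪ {(1,+1)_e}`. -/
def Digit.Valid (d : Digit) : Prop :=
  (2 ≤ d.a ∧ (d.eps = 1 ∨ d.eps = -1)) ∨ (d.a = 1 ∧ d.eps = 1 ∧ d.s = Par.e)

/-- The branch intervals `I_{(a,ε)_s}` of the SCF map. -/
noncomputable def branch (d : Digit) : Set ℝ :=
  match d.s with
  | Par.e =>
      if d.a = 1 then Set.Icc (1/3 : ℝ) (1/2)
      else if d.eps = 1 then Set.Ico (1 / (2 * (d.a : ℝ) + 1)) (1 / (2 * (d.a : ℝ)))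
      else Set.Ico (1 / (2 * (d.a : ℝ))) (1 / (2 * (d.a : ℝ) - 1))
  | Par.o =>
      if d.eps = 1 then
        Set.Ioc ((2 * (d.a : ℝ) - 1) / (2 * (d.a : ℝ) + 1)) ((d.a : ℝ) / ((d.a : ℝ) + 1))
      else
        Set.Ioc (((d.a : ℝ) - 1) / (d.a : ℝ)) ((2 * (d.a : ℝ) - 1) / (2 * (d.a : ℝ) + 1))

open Classical in
/-- The SCF digit of a point `y` (the unique valid digit `d` with `y ∈ I_d`;
well defined for every `y ∈ (0,1)`). -/
noncomputable def digit (y : ℝ) : Digit :=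
  if h : ∃ d : Digit, d.Valid ∧ y ∈ branch d then h.choose else ⟨1, 1, Par.e⟩

/-- The `n`-th SCF digit `(a_n(x), ε_n(x))_{s_n(x)}` of `x`, `n ≥ 1`,
determined by `T^[n−1] x ∈ I_{(a_n,ε_n)_{s_n}}`. -/
noncomputable def dig (n : ℕ) (x : ℝ) : Digit := digit (T^[n - 1] x)

/-- The `n`-th SCF partial quotient `a_n(x)`. -/
noncomputable def a (n : ℕ) (x : ℝ) : ℤ := (dig n x).a

/-- The invariant density `f_μ`. -/
noncomputable def fdens (x : ℝ) : ℝ :=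
  2 / (Real.log (2 + Real.sqrt 3) * (1 - (2 - Real.sqrt 3) * x) * (1 + Real.sqrt 3 * x))

/-- The absolutely continuous `T`-invariant probability measure `μ` on `(0,1)`. -/
noncomputable def mu : Measure ℝ :=
  (volume.restrict (Set.Ioo (0 : ℝ) 1)).withDensity fun x => ENNReal.ofReal (fdens x)

/-- The inverse branches `h_{(a,ε)_s}` of the SCF map `T`. -/
noncomputable def h (d : Digit) (x : ℝ) : ℝ :=
  match d.s with
  | Par.e => 1 / (2 * (d.a : ℝ) + (d.eps : ℝ) * x)
  | Par.o =>
      if d.eps = 1 then (((d.a : ℝ) - 1) * x + (d.a : ℝ)) / ((d.a : ℝ) * x + ((d.a : ℝ) + 1))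
      else ((d.a : ℝ) * x + ((d.a : ℝ) - 1)) / (((d.a : ℝ) + 1) * x + (d.a : ℝ))

/-- Composed inverse branch `h_{A^{(n)}} = h_{A₁} ∘ ⋯ ∘ h_{A_n}` of a word. -/
noncomputable def hWord (l : List Digit) : ℝ → ℝ :=
  l.foldr (fun d g => h d ∘ g) id

/-- The dual inverse branches `bar h_{(b,η)_t}`. -/
noncomputable def hbar (d : Digit) (y : ℝ) : ℝ :=
  match d.s with
  | Par.e => (d.eps : ℝ) / (2 * (d.a : ℝ) + y)
  | Par.o =>
      1 / (1 + (d.eps : ℝ) / (((d.a : ℝ) - ((max 0 d.eps : ℤ) : ℝ)) + 1 / (1 + y)))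

/-- The matrix `M_{(a,ε)_s}` associated with the inverse branch `h_{(a,ε)_s}`. -/
noncomputable def Mdig (d : Digit) : Matrix (Fin 2) (Fin 2) ℝ :=
  match d.s with
  | Par.e => !![0, 1; (d.eps : ℝ), 2 * (d.a : ℝ)]
  | Par.o =>
      !![(d.a : ℝ) - ((max 0 d.eps : ℤ) : ℝ), (d.a : ℝ) - ((max 0 d.eps : ℤ) : ℝ) + (d.eps : ℝ);
         (d.a : ℝ) - ((max 0 d.eps : ℤ) : ℝ) + 1, (d.a : ℝ) - ((max 0 d.eps : ℤ) : ℝ) + (d.eps : ℝ) + 1]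

/-- `M_n(x) = M_{(a₁,ε₁)_{s₁}} ⋯ M_{(a_n,ε_n)_{s_n}}`. -/
noncomputable def Mn (n : ℕ) (x : ℝ) : Matrix (Fin 2) (Fin 2) ℝ :=
  ((List.range n).map fun i => Mdig (digit (T^[i] x))).prod

/-- `P_n(x)`: the `(1,2)`-entry of `M_n(x)` (numerator of the `n`-th convergent). -/
noncomputable def Pc (n : ℕ) (x : ℝ) : ℝ := Mn n x 0 1

/-- `Q_n(x)`: the `(2,2)`-entry of `M_n(x)` (denominator of the `n`-th convergent). -/
noncomputable def Qc (n : ℕ) (x : ℝ) : ℝ := Mn n x 1 1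


/-- The irrational points of the open unit interval. -/
def X0 : Set ℝ := {x | x ∈ Set.Ioo (0 : ℝ) 1 ∧ Irrational x}

lemma iota_iota {x : ℝ} (hx : 0 ≤ x) : iota (iota x) = x := by
  unfold iota
  have : (1 + x) ≠ 0 := by linarith
  field_simp
  ring

lemma iota_mem_Ioo {x : ℝ} (hx : x ∈ Ioo (0 : ℝ) 1) : iota x ∈ Ioo (0 : ℝ) 1 := by
  obtain ⟨h0, h1⟩ := hx
  unfold iota
  constructor
  · apply div_pos <;> linarith
  · rw [div_lt_one (by linarith)]; linarith

lemma irr_affine {x : ℝ} (hx : Irrational x) (k e : ℤ) (he : e = 1 ∨ e = -1) :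
    Irrational (2 * (k : ℝ) + (e : ℝ) * x) := by
  have h1 : Irrational ((e : ℝ) * x) := hx.intCast_mul (by rcases he with h | h <;> simp [h])
  have := h1.intCast_add (2 * k)
  simpa using this

lemma irr_iota {x : ℝ} (h0 : 0 ≤ x) (hx : Irrational x) : Irrational (iota x) := by
  have h1 : Irrational ((1 : ℤ) + x) := hx.intCast_add 1
  have h2 : Irrational (((2 : ℤ) : ℝ) / ((1 : ℤ) + x)) := h1.intCast_div (by norm_num)
  have h3 := h2.sub_intCast 1
  have : iota x = ((2 : ℤ) : ℝ) / ((1 : ℤ) + x) - (1 : ℤ) := by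
    unfold iota
    have : (1 + x) ≠ 0 := by linarith
    push_cast
    field_simp
    ring
  rwa [this]

lemma iota_mem_X0 {x : ℝ} (hx : x ∈ X0) : iota x ∈ X0 :=
  ⟨iota_mem_Ioo hx.1, irr_iota hx.1.1.le hx.2⟩

/-- The even coordinate of a digit. -/
lemma even_u_bounds {k e : ℤ} (hk : (2 ≤ k ∧ (e = 1 ∨ e = -1)) ∨ (k = 1 ∧ e = 1))
    {z : ℝ} (hz : z ∈ Ioo (0 : ℝ) 1) : 2 < 2 * (k : ℝ) + (e : ℝ) * z := by
  obtain ⟨h0, h1⟩ := hz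
  rcases hk with ⟨h2, h | h⟩ | ⟨h2, h⟩
  · have : (2 : ℝ) ≤ k := by exact_mod_cast h2
    subst h; push_cast; linarith
  · have : (2 : ℝ) ≤ k := by exact_mod_cast h2
    subst h; push_cast; linarith
  · subst h h2; push_cast; linarith

lemma even_u_bounds' {k e : ℤ} (hk : 2 ≤ k ∧ (e = 1 ∨ e = -1))
    {z : ℝ} (hz : z ∈ Ioo (0 : ℝ) 1) : 3 < 2 * (k : ℝ) + (e : ℝ) * z := by
  obtain ⟨h0, h1⟩ := hz
  rcases hk with ⟨h2, h | h⟩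
  · have : (2 : ℝ) ≤ k := by exact_mod_cast h2
    subst h; push_cast; linarith
  · have : (2 : ℝ) ≤ k := by exact_mod_cast h2
    subst h; push_cast; linarith

lemma Te_branch {k e : ℤ} (he : e = 1 ∨ e = -1) {z : ℝ} (hz : z ∈ Ioo (0 : ℝ) 1) :
    Te (1 / (2 * (k : ℝ) + (e : ℝ) * z)) = z := by
  obtain ⟨h0, h1⟩ := hz
  unfold Te
  rw [one_div_one_div]
  have hf : ⌊(2 * (k : ℝ) + (e : ℝ) * z + 1) / 2⌋ = k := by
    rw [Int.floor_eq_iff]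
    rcases he with h | h <;> subst h <;> push_cast <;> constructor <;> linarith
  rw [hf]
  rcases he with h | h
  · subst h
    rw [show 2 * (k : ℝ) + ((1 : ℤ) : ℝ) * z - 2 * k = z by push_cast; ring]
    exact abs_of_pos h0
  · subst h
    rw [show 2 * (k : ℝ) + ((-1 : ℤ) : ℝ) * z - 2 * k = -z by push_cast; ring, abs_neg]
    exact abs_of_pos h0

lemma h_odd {k e : ℤ} (hk : 2 ≤ k ∧ (e = 1 ∨ e = -1)) {z : ℝ} (hz : z ∈ Ioo (0 : ℝ) 1) :
    h ⟨k, e, Par.o⟩ z = iota (1 / (2 * (k : ℝ) + (e : ℝ) * iota z)) := by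
  have hu := even_u_bounds' hk (iota_mem_Ioo hz)
  obtain ⟨h0, h1⟩ := hz
  have hk2 : (2 : ℝ) ≤ k := by exact_mod_cast hk.1
  have hz1 : (1 + z) ≠ 0 := by linarith
  have hu1 : (2 * (k : ℝ) + (e : ℝ) * iota z) + 1 ≠ 0 := by linarith
  have hu0 : (2 * (k : ℝ) + (e : ℝ) * iota z) ≠ 0 := by linarith
  have key : iota (1 / (2 * (k : ℝ) + (e : ℝ) * iota z)) =
      ((2 * (k : ℝ) + (e : ℝ) * iota z) - 1) / ((2 * (k : ℝ) + (e : ℝ) * iota z) + 1) := by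
    generalize (2 * (k : ℝ) + (e : ℝ) * iota z) = u at *
    unfold iota
    field_simp
  rw [key]
  rcases hk with ⟨h2, h | h⟩
  · subst h
    simp only [SCF.h, if_true]
    have d1 : (k : ℝ) * z + (k + 1) ≠ 0 := by positivity
    rw [div_eq_div_iff d1 hu1]
    unfold iota
    push_cast
    field_simp
    ring
  · subst h
    simp only [SCF.h]
    rw [if_neg (by norm_num)]
    have d1 : ((k : ℝ) + 1) * z + k ≠ 0 := by positivity
    rw [div_eq_div_iff d1 hu1]
    unfold iota
    push_cast
    field_simp
    ring

lemma iota_lt {y : ℝ} (h0 : 0 < y) (h1 : y < 1 / 3) : 1 / 2 < iota y := by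
  unfold iota
  rw [lt_div_iff₀ (by linarith)]
  linarith

lemma valid_e {k e : ℤ} (hv : Digit.Valid ⟨k, e, Par.e⟩) :
    (2 ≤ k ∧ (e = 1 ∨ e = -1)) ∨ (k = 1 ∧ e = 1) := by
  simpa [Digit.Valid] using hv

lemma valid_o {k e : ℤ} (hv : Digit.Valid ⟨k, e, Par.o⟩) : 2 ≤ k ∧ (e = 1 ∨ e = -1) := by
  simpa [Digit.Valid] using hv

lemma valid_eps {d : Digit} (hv : d.Valid) : d.eps = 1 ∨ d.eps = -1 := by
  rcases hv with h | h
  · exact h.2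
  · exact Or.inl h.2.1

/-- The two coordinates which turn branches into unit intervals. -/
noncomputable def coord (s : Par) (x : ℝ) : ℝ :=
  match s with
  | Par.e => 1 / x
  | Par.o => 1 / iota x

noncomputable def zcoord (s : Par) (x : ℝ) : ℝ :=
  match s with
  | Par.e => x
  | Par.o => iota x

lemma zcoord_mem {z : ℝ} (hz : z ∈ Ioo (0 : ℝ) 1) (s : Par) : zcoord s z ∈ Ioo (0 : ℝ) 1 := by
  cases s
  · exact hz
  · exact iota_mem_Ioo hz

lemma h_mem_X0 {d : Digit} (hv : d.Valid) {z : ℝ} (hz : z ∈ X0) : h d z ∈ X0 := by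
  obtain ⟨k, e, s⟩ := d
  have he : e = 1 ∨ e = -1 := valid_eps hv
  cases s
  · have hu := even_u_bounds (valid_e hv) hz.1
    have hi := irr_affine hz.2 k e he
    change 1 / (2 * (k : ℝ) + (e : ℝ) * z) ∈ X0
    refine ⟨⟨by positivity, ?_⟩, ?_⟩
    · rw [div_lt_one (by linarith)]; linarith
    · rw [one_div]; exact hi.inv
  · rw [h_odd (valid_o hv) hz.1]
    have hw := iota_mem_X0 hz
    have hu := even_u_bounds' (valid_o hv) hw.1
    have hi := irr_affine hw.2 k e he
    apply iota_mem_X0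
    refine ⟨⟨by positivity, ?_⟩, ?_⟩
    · rw [div_lt_one (by linarith)]; linarith
    · rw [one_div]; exact hi.inv

lemma T_h {d : Digit} (hv : d.Valid) {z : ℝ} (hz : z ∈ X0) : T (h d z) = z := by
  have hx := (h_mem_X0 hv hz).1
  obtain ⟨k, e, s⟩ := d
  have he : e = 1 ∨ e = -1 := valid_eps hv
  unfold T
  rw [if_neg (not_le.2 hx.1), if_neg (not_le.2 hx.2)]
  cases s
  · have hu := even_u_bounds (valid_e hv) hz.1
    have hh : h ⟨k, e, Par.e⟩ z = 1 / (2 * (k : ℝ) + (e : ℝ) * z) := rfl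
    rw [hh, if_pos (one_div_le_one_div_of_le (by norm_num) hu.le)]
    exact Te_branch he hz.1
  · have hw := iota_mem_X0 hz
    have hu := even_u_bounds' (valid_o hv) hw.1
    have h3 : 1 / (2 * (k : ℝ) + (e : ℝ) * iota z) < 1 / 3 :=
      one_div_lt_one_div_of_lt (by norm_num) hu
    rw [h_odd (valid_o hv) hz.1, if_neg (not_le.2 (iota_lt (by positivity) h3)),
      iota_iota (by positivity), Te_branch he hw.1, iota_iota hz.1.1.le]

lemma coord_h {d : Digit} (hv : d.Valid) {z : ℝ} (hz : z ∈ X0) :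
    coord d.s (h d z) = 2 * (d.a : ℝ) + (d.eps : ℝ) * zcoord d.s z ∧
    (d.s = Par.e ↔ h d z ≤ 1 / 2) := by
  obtain ⟨k, e, s⟩ := d
  cases s
  · have hu := even_u_bounds (valid_e hv) hz.1
    have hh : h ⟨k, e, Par.e⟩ z = 1 / (2 * (k : ℝ) + (e : ℝ) * z) := rfl
    rw [hh]
    simp only [coord, zcoord, one_div_one_div, true_and, true_iff]
    have := one_div_le_one_div_of_le (by norm_num) hu.le
    simpa using this
  · have hw := iota_mem_X0 hz
    have hu := even_u_bounds' (valid_o hv) hw.1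
    have h3 : 1 / (2 * (k : ℝ) + (e : ℝ) * iota z) < 1 / 3 :=
      one_div_lt_one_div_of_lt (by norm_num) hu
    rw [h_odd (valid_o hv) hz.1]
    simp only [coord, zcoord]
    rw [iota_iota (by positivity), one_div_one_div]
    have := iota_lt (by positivity) h3
    refine ⟨rfl, ?_⟩
    simp only [reduceCtorEq, false_iff, not_le]
    exact this

lemma branch_coord {d : Digit} (hv : d.Valid) {x : ℝ} (hx : x ∈ Ioo (0 : ℝ) 1)
    (hb : x ∈ branch d) :
    ((d.eps = 1 ∧ 2 * (d.a : ℝ) ≤ coord d.s x ∧ coord d.s x ≤ 2 * (d.a : ℝ) + 1) ∨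
     (d.eps = -1 ∧ 2 * (d.a : ℝ) - 1 ≤ coord d.s x ∧ coord d.s x ≤ 2 * (d.a : ℝ))) ∧
    (d.s = Par.e ↔ x ≤ 1 / 2) := by
  obtain ⟨k, e, s⟩ := d
  obtain ⟨h0, h1⟩ := hx
  cases s
  · rcases valid_e hv with ⟨h2, he⟩ | ⟨h2, he⟩
    · have hk2 : (2 : ℝ) ≤ k := by exact_mod_cast h2
      simp only [branch] at hb
      rw [if_neg (by omega)] at hb
      rcases he with he | he
      · subst he
        rw [if_pos rfl] at hb
        obtain ⟨b1, b2⟩ := hb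
        rw [div_le_iff₀ (by linarith)] at b1
        rw [lt_div_iff₀ (by linarith)] at b2
        simp only [coord, true_and, true_iff]
        refine ⟨Or.inl ⟨?_, ?_⟩, ?_⟩
        · rw [le_div_iff₀ h0]; linarith
        · rw [div_le_iff₀ h0]; linarith
        · nlinarith
      · subst he
        rw [if_neg (by norm_num)] at hb
        obtain ⟨b1, b2⟩ := hb
        rw [div_le_iff₀ (by linarith)] at b1
        rw [lt_div_iff₀ (by linarith)] at b2
        simp only [coord, true_and, true_iff]
        refine ⟨Or.inr ⟨?_, ?_⟩, ?_⟩
        · rw [le_div_iff₀ h0]; linarith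
        · rw [div_le_iff₀ h0]; linarith
        · nlinarith
    · subst h2 he
      simp only [branch, if_true] at hb
      obtain ⟨b1, b2⟩ := hb
      simp only [coord, true_and, true_iff]
      push_cast
      refine ⟨Or.inl ⟨?_, ?_⟩, b2⟩
      · rw [le_div_iff₀ h0]; linarith
      · rw [div_le_iff₀ h0]; linarith
  · have hk := valid_o hv
    have hk2 : (2 : ℝ) ≤ k := by exact_mod_cast hk.1
    have hc : coord Par.o x = (1 + x) / (1 - x) := by
      simp [coord, iota]
    have h1' : 0 < 1 - x := by linarith
    rcases hk.2 with he | he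
    · subst he
      simp only [branch, if_true] at hb
      obtain ⟨b1, b2⟩ := hb
      rw [div_lt_iff₀ (by linarith)] at b1
      rw [le_div_iff₀ (by linarith)] at b2
      simp only [true_and, hc, reduceCtorEq, false_iff, not_le]
      refine ⟨Or.inl ⟨?_, ?_⟩, ?_⟩
      · rw [le_div_iff₀ h1']; linarith
      · rw [div_le_iff₀ h1']; linarith
      · nlinarith
    · subst he
      simp only [branch] at hb
      rw [if_neg (by norm_num)] at hb
      obtain ⟨b1, b2⟩ := hb
      rw [div_lt_iff₀ (by linarith)] at b1
      rw [le_div_iff₀ (by linarith)] at b2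
      simp only [true_and, hc, reduceCtorEq, false_iff, not_le]
      refine ⟨Or.inr ⟨?_, ?_⟩, ?_⟩
      · rw [le_div_iff₀ h1']; linarith
      · rw [div_le_iff₀ h1']; linarith
      · nlinarith

lemma h_mem_branch {d : Digit} (hv : d.Valid) {z : ℝ} (hz : z ∈ X0) : h d z ∈ branch d := by
  have hx := (h_mem_X0 hv hz).1
  have hc := (coord_h hv hz).1
  have hzz := zcoord_mem hz.1 d.s
  obtain ⟨k, e, s⟩ := d
  generalize h ⟨k, e, s⟩ z = x at *
  generalize hq : zcoord s z = q at *
  obtain ⟨h0, h1⟩ := hx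
  obtain ⟨q0, q1⟩ := hzz
  cases s
  · simp only [coord] at hc
    rw [div_eq_iff h0.ne'] at hc
    rcases valid_e hv with ⟨h2, he⟩ | ⟨h2, he⟩
    · have hk2 : (2 : ℝ) ≤ k := by exact_mod_cast h2
      simp only [branch]
      rw [if_neg (by omega)]
      rcases he with he | he
      · subst he
        rw [if_pos rfl]
        push_cast at hc
        constructor
        · rw [div_le_iff₀ (by linarith)]; nlinarith
        · rw [lt_div_iff₀ (by linarith)]; nlinarith
      · subst he
        rw [if_neg (by norm_num)]
        push_cast at hc
        constructor
        · rw [div_le_iff₀ (by linarith)]; nlinarith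
        · rw [lt_div_iff₀ (by linarith)]; nlinarith
    · subst h2 he
      push_cast at hc
      simp only [branch, if_true]
      constructor
      · nlinarith
      · nlinarith
  · have hk := valid_o hv
    have hk2 : (2 : ℝ) ≤ k := by exact_mod_cast hk.1
    have h1' : 0 < 1 - x := by linarith
    have hc' : coord Par.o x = (1 + x) / (1 - x) := by
      simp [coord, iota]
    simp only at hc
    rw [hc', div_eq_iff h1'.ne'] at hc
    have e1 : 0 < q * (1 - x) := mul_pos q0 h1'
    have e2 : q * (1 - x) < 1 - x := by nlinarith
    rcases hk.2 with he | he
    · subst he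
      simp only [branch, if_true]
      push_cast at hc
      constructor
      · rw [div_lt_iff₀ (by linarith)]; nlinarith
      · rw [le_div_iff₀ (by linarith)]; nlinarith
    · subst he
      simp only [branch]
      rw [if_neg (by norm_num)]
      push_cast at hc
      constructor
      · rw [div_lt_iff₀ (by linarith)]; nlinarith
      · rw [le_div_iff₀ (by linarith)]; nlinarith

lemma digit_h {d : Digit} (hv : d.Valid) {z : ℝ} (hz : z ∈ X0) : digit (h d z) = d := by
  have hex : ∃ d' : Digit, d'.Valid ∧ h d z ∈ branch d' := ⟨d, hv, h_mem_branch hv hz⟩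
  have hx := (h_mem_X0 hv hz).1
  unfold digit
  rw [dif_pos hex]
  obtain ⟨hv', hb'⟩ := hex.choose_spec
  generalize hex.choose = d' at *
  obtain ⟨c1, c2⟩ := coord_h hv hz
  obtain ⟨b1, b2⟩ := branch_coord hv' hx hb'
  have hs : d'.s = d.s := by
    have := b2.trans c2.symm
    cases hd : d.s <;> cases hd' : d'.s <;> simp_all
  rw [hs, c1] at b1
  obtain ⟨q0, q1⟩ := zcoord_mem hz.1 d.s
  have he := valid_eps hv
  obtain ⟨k, e, s⟩ := d
  obtain ⟨k', e', s'⟩ := d'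
  simp only at *
  generalize zcoord s z = q at *
  have : k' = k ∧ e' = e := by
    rcases he with he | he <;> rcases b1 with ⟨he', b1, b3⟩ | ⟨he', b1, b3⟩ <;> subst he he' <;>
      push_cast at b1 b3
    · have i1 : (2 * k' : ℝ) < 2 * k + 1 := by linarith
      have i2 : (2 * k : ℝ) < 2 * k' + 1 := by linarith
      have i1' : (2 * k' : ℤ) < 2 * k + 1 := by exact_mod_cast i1
      have i2' : (2 * k : ℤ) < 2 * k' + 1 := by exact_mod_cast i2
      omega
    · have i1 : (2 * k' : ℝ) < 2 * k + 2 := by linarith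
      have i2 : (2 * k : ℝ) < 2 * k' := by linarith
      have i1' : (2 * k' : ℤ) < 2 * k + 2 := by exact_mod_cast i1
      have i2' : (2 * k : ℤ) < 2 * k' := by exact_mod_cast i2
      omega
    · have i1 : (2 * k' : ℝ) < 2 * k := by linarith
      have i2 : (2 * k : ℝ) < 2 * k' + 2 := by linarith
      have i1' : (2 * k' : ℤ) < 2 * k := by exact_mod_cast i1
      have i2' : (2 * k : ℤ) < 2 * k' + 2 := by exact_mod_cast i2
      omega
    · have i1 : (2 * k' : ℝ) < 2 * k + 1 := by linarith
      have i2 : (2 * k : ℝ) < 2 * k' + 1 := by linarith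
      have i1' : (2 * k' : ℤ) < 2 * k + 1 := by exact_mod_cast i1
      have i2' : (2 * k : ℤ) < 2 * k' + 1 := by exact_mod_cast i2
      omega
  rw [this.1, this.2, hs]

/-- every irrational `x < 1` lies in the image of an even inverse branch. -/
lemma exists_even {x : ℝ} (hx : x ∈ X0) : ∃ k e : ℤ, ∃ z ∈ X0,
    1 ≤ k ∧ (e = 1 ∨ e = -1) ∧ x = 1 / (2 * (k : ℝ) + (e : ℝ) * z) := by
  obtain ⟨⟨h0, h1⟩, hi⟩ := hx
  set k := ⌊(1 / x + 1) / 2⌋ with hk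
  have f1 := Int.floor_le ((1 / x + 1) / 2)
  have f2 := Int.lt_floor_add_one ((1 / x + 1) / 2)
  rw [← hk] at f1 f2
  have hx1 : 1 < 1 / x := by rw [lt_div_iff₀ h0]; linarith
  have hki : 1 ≤ k := by
    rw [hk, Int.le_floor]; push_cast; linarith
  have hinv : Irrational (1 / x) := by rw [one_div]; exact hi.inv
  have hirr : Irrational (1 / x - ((2 * k : ℤ) : ℝ)) := hinv.sub_intCast _
  have hneg : Irrational (-(1 / x - ((2 * k : ℤ) : ℝ))) := hirr.neg
  push_cast at hirr hneg
  have n0 := hirr.ne_int 0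
  have n1 := hirr.ne_int (-1)
  push_cast at n0 n1
  rcases lt_or_gt_of_ne n0 with hl | hl
  · refine ⟨k, -1, -(1 / x - 2 * k), ⟨⟨by linarith, ?_⟩, hneg⟩, hki, Or.inr rfl, ?_⟩
    · have : -1 ≤ 1 / x - 2 * k := by linarith
      have := lt_of_le_of_ne this (Ne.symm n1)
      linarith
    · push_cast
      rw [show 2 * (k : ℝ) + -1 * -(1 / x - 2 * k) = 1 / x by ring, one_div_one_div]
  · refine ⟨k, 1, 1 / x - 2 * k, ⟨⟨hl, by linarith⟩, hirr⟩, hki, Or.inl rfl, ?_⟩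
    push_cast
    rw [show 2 * (k : ℝ) + 1 * (1 / x - 2 * k) = 1 / x by ring, one_div_one_div]

lemma exists_h {x : ℝ} (hx : x ∈ X0) : ∃ d : Digit, d.Valid ∧ ∃ z ∈ X0, x = h d z := by
  rcases le_or_gt x (1 / 2) with hl | hl
  · obtain ⟨k, e, z, hz, hk, he, hxe⟩ := exists_even hx
    refine ⟨⟨k, e, Par.e⟩, ?_, z, hz, hxe⟩
    obtain ⟨z0, z1⟩ := hz.1
    simp only [Digit.Valid]
    rcases he with he | he
    · subst he
      rcases eq_or_lt_of_le hk with h1 | h1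
      · right; exact ⟨h1.symm, by simp⟩
      · left; exact ⟨h1, Or.inl rfl⟩
    · subst he
      left
      refine ⟨?_, Or.inr rfl⟩
      by_contra hlt
      have hk1 : k = 1 := by omega
      subst hk1
      push_cast at hxe
      have : 0 < 2 * (1 : ℝ) + -1 * z := by linarith
      rw [eq_div_iff this.ne'] at hxe
      have hx0 := hx.1.1
      nlinarith
  · obtain ⟨k, e, z, hz, hk, he, hxe⟩ := exists_even (iota_mem_X0 hx)
    obtain ⟨z0, z1⟩ := hz.1
    have hk2 : 2 ≤ k := by
      by_contra hlt
      have hk1 : k = 1 := by omega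
      subst hk1
      have hp : 0 < 2 * ((1 : ℤ) : ℝ) + (e : ℝ) * z := by
        rcases he with he | he <;> subst he <;> push_cast <;> linarith
      have hp3 : 2 * ((1 : ℤ) : ℝ) + (e : ℝ) * z < 3 := by
        rcases he with he | he <;> subst he <;> push_cast <;> linarith
      have : 1 / 3 < iota x := by
        rw [hxe]; exact one_div_lt_one_div_of_lt hp hp3
      unfold iota at this
      rw [lt_div_iff₀ (by linarith [hx.1.1])] at this
      linarith
    refine ⟨⟨k, e, Par.o⟩, Or.inl ⟨hk2, he⟩, iota z, iota_mem_X0 hz, ?_⟩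
    rw [h_odd ⟨hk2, he⟩ (iota_mem_Ioo hz.1), iota_iota hz.1.1.le, ← hxe, iota_iota hx.1.1.le]

/-- Set of points whose first `N` digits are at most `K`. -/
def AS (K N : ℕ) : Set ℝ :=
  {x | x ∈ X0 ∧ ∀ i < N, (digit (T^[i] x)).a ≤ (K : ℤ)}

lemma AS_zero (K : ℕ) : AS K 0 = X0 := by
  ext x; simp [AS]

lemma AS_subset (K N : ℕ) : AS K N ⊆ X0 := fun _ hx => hx.1

lemma mem_AS_succ {K N : ℕ} {d : Digit} (hv : d.Valid) {z : ℝ} (hz : z ∈ X0) :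
    h d z ∈ AS K (N + 1) ↔ d.a ≤ (K : ℤ) ∧ z ∈ AS K N := by
  simp only [AS, mem_ofPred_eq, h_mem_X0 hv hz, hz, true_and]
  constructor
  · intro H
    refine ⟨by simpa [digit_h hv hz] using H 0 (by omega), fun i hi => ?_⟩
    have := H (i + 1) (by omega)
    rwa [Function.iterate_succ_apply, T_h hv hz] at this
  · rintro ⟨h1, h2⟩ i hi
    rcases i with _ | i
    · simpa [digit_h hv hz] using h1
    · rw [Function.iterate_succ_apply, T_h hv hz]
      exact h2 i (by omega)

/-- Valid digits with `a ≤ n + 1`. -/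
def S : ℕ → Finset Digit
  | 0 => {⟨1, 1, Par.e⟩}
  | (n + 1) => S n ∪ {⟨n + 2, 1, Par.e⟩, ⟨n + 2, -1, Par.e⟩, ⟨n + 2, 1, Par.o⟩, ⟨n + 2, -1, Par.o⟩}

lemma mem_S (n : ℕ) (d : Digit) : d ∈ S n ↔ d.Valid ∧ d.a ≤ (n + 1 : ℤ) := by
  induction n with
  | zero =>
    obtain ⟨k, e, s⟩ := d
    simp only [S, Finset.mem_singleton, Digit.mk.injEq, Digit.Valid]
    constructor
    · rintro ⟨rfl, rfl, rfl⟩; simp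
    · rintro ⟨h1 | h1, h2⟩
      · simp at h2; omega
      · exact h1
  | succ n ih =>
    rw [S, Finset.mem_union, ih]
    obtain ⟨k, e, s⟩ := d
    simp only [Finset.mem_insert, Finset.mem_singleton, Digit.mk.injEq, Digit.Valid]
    push_cast
    constructor
    · rintro (⟨h1, h2⟩ | ⟨rfl, rfl, rfl⟩ | ⟨rfl, rfl, rfl⟩ | ⟨rfl, rfl, rfl⟩ | ⟨rfl, rfl, rfl⟩)
      · exact ⟨h1, by omega⟩
      all_goals
        refine ⟨Or.inl ⟨by omega, by simp⟩, by omega⟩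
    · rintro ⟨h1, h2⟩
      by_cases hk : k ≤ n + 1
      · exact Or.inl ⟨h1, hk⟩
      · right
        have hk2 : k = n + 2 := by omega
        rcases h1 with ⟨_, he⟩ | ⟨h1, _⟩
        · cases s <;> rcases he with rfl | rfl <;> simp [hk2]
        · omega

lemma AS_succ (n N : ℕ) : AS (n + 1) (N + 1) = ⋃ d ∈ S n, h d '' AS (n + 1) N := by
  ext x
  simp only [mem_iUnion, mem_image, exists_prop]
  constructor
  · intro hx
    obtain ⟨d, hv, z, hz, rfl⟩ := exists_h hx.1
    obtain ⟨h1, h2⟩ := (mem_AS_succ hv hz).1 hx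
    exact ⟨d, (mem_S n d).2 ⟨hv, by exact_mod_cast h1⟩, z, h2, rfl⟩
  · rintro ⟨d, hd, z, hz, rfl⟩
    obtain ⟨hv, h1⟩ := (mem_S n d).1 hd
    exact (mem_AS_succ hv hz.1).2 ⟨by exact_mod_cast h1, hz⟩

lemma disj_h (n N : ℕ) :
    (↑(S n) : Set Digit).Pairwise (Function.onFun Disjoint fun d => h d '' AS (n + 1) N) := by
  intro d hd d' hd' hne
  rw [Function.onFun, Set.disjoint_left]
  rintro x ⟨z, hz, rfl⟩ ⟨z', hz', he⟩
  have h1 := digit_h ((mem_S n d).1 hd).1 hz.1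
  have h2 := digit_h ((mem_S n d').1 hd').1 hz'.1
  rw [he, h1] at h2
  exact hne h2

lemma injOn_h {d : Digit} (hv : d.Valid) : InjOn (h d) X0 := by
  intro x hx y hy hxy
  rw [← T_h hv hx, hxy, T_h hv hy]

lemma target_set_eq (K N : ℕ) (t : ℝ) (ht : ⌊t⌋ = (K : ℤ)) :
    {x : ℝ | x ∈ Set.Ioo (0 : ℝ) 1 ∧ Irrational x ∧
            ∀ n : ℕ, 1 ≤ n → n ≤ N → (a n x : ℝ) ≤ t} = AS K N := by
  ext x
  simp only [AS, X0, mem_ofPred_eq, and_assoc, a, dig]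
  refine and_congr_right fun _ => and_congr_right fun _ => ?_
  constructor
  · intro H i hi
    have := H (i + 1) (by omega) (by omega)
    rwa [← Int.le_floor, ht] at this
  · intro H n h1 h2
    rw [← Int.le_floor, ht]
    exact H (n - 1) (by omega)

/-- Abbreviation for `√3`. -/
noncomputable def cc : ℝ := Real.sqrt 3

lemma cc_sq : cc ^ 2 = 3 := Real.sq_sqrt (by norm_num)

lemma cc_gt : 1.732 < cc := by
  unfold cc
  exact Real.lt_sqrt_of_sq_lt (by norm_num)

lemma cc_lt : cc < 1.7321 := by
  unfold cc
  rw [Real.sqrt_lt' (by norm_num)]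
  norm_num

noncomputable def DD (x : ℝ) : ℝ := (1 - (2 - cc) * x) * (1 + cc * x)

noncomputable def LD (x : ℝ) : ℝ := cc / (1 + cc * x) - (2 - cc) / (1 - (2 - cc) * x)

lemma f1_pos {x : ℝ} (hx : x ∈ Icc (0 : ℝ) 1) : 0 < 1 - (2 - cc) * x := by
  have := cc_gt; have := cc_lt
  nlinarith [hx.1, hx.2]

lemma f2_pos {x : ℝ} (hx : x ∈ Icc (0 : ℝ) 1) : 1 ≤ 1 + cc * x := by
  have := cc_gt
  nlinarith [hx.1, hx.2]

lemma DD_pos {x : ℝ} (hx : x ∈ Icc (0 : ℝ) 1) : 0 < DD x :=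
  mul_pos (f1_pos hx) (by linarith [f2_pos hx])

lemma DD_eq (x : ℝ) : DD x = 1 + (2 * cc - 2) * x - (2 * cc - 3) * x ^ 2 := by
  unfold DD
  linear_combination x ^ 2 * cc_sq

lemma DD_le {x : ℝ} (hx : x ∈ Icc (0 : ℝ) 1) : DD x ≤ 2 := by
  have := cc_gt; have := cc_lt
  rw [DD_eq]
  nlinarith [hx.1, hx.2, mul_nonneg hx.1 (sub_nonneg.2 hx.2)]

lemma LD_eq {x : ℝ} (hx : x ∈ Icc (0 : ℝ) 1) :
    LD x = ((2 * cc - 2) - 2 * (2 * cc - 3) * x) / DD x := by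
  have h1 := f1_pos hx
  have h2 := f2_pos hx
  have h2' : (1 + cc * x) ≠ 0 := by linarith
  unfold LD DD
  rw [div_sub_div _ _ h2' h1.ne', mul_comm (1 - (2 - cc) * x)]
  congr 1
  linear_combination (2 * x) * cc_sq

lemma LD_nonneg {x : ℝ} (hx : x ∈ Icc (0 : ℝ) 1) : 0 ≤ LD x := by
  have := cc_gt; have := cc_lt
  rw [LD_eq hx]
  apply div_nonneg _ (DD_pos hx).le
  nlinarith [hx.1, hx.2]

lemma LD_le {x : ℝ} (hx : x ∈ Icc (0 : ℝ) 1) : LD x ≤ 1.47 - 1.19 * x := by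
  have h1 := cc_gt; have h2 := cc_lt
  obtain ⟨x0, x1⟩ := hx
  rw [LD_eq ⟨x0, x1⟩, div_le_iff₀ (DD_pos ⟨x0, x1⟩), DD_eq]
  have key : 0 ≤ (1.47 - 1.19 * x) * (1 + 1.464 * x - 0.4642 * x ^ 2)
      - (1.4642 - 0.928 * x) := by
    nlinarith [mul_nonneg x0 (sub_nonneg.2 x1), mul_nonneg x0 (mul_nonneg x0 (sub_nonneg.2 x1)),
      mul_nonneg (mul_nonneg x0 x0) x0]
  have a1 : 1 + 1.464 * x - 0.4642 * x ^ 2 ≤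
      1 + (2 * cc - 2) * x - (2 * cc - 3) * x ^ 2 := by
    have : 0 ≤ (2 * cc - 3.464) * x := mul_nonneg (by linarith) x0
    have : 0 ≤ (3.4642 - 2 * cc) * x ^ 2 := mul_nonneg (by linarith) (by positivity)
    nlinarith
  have a2 : (2 * cc - 2) - 2 * (2 * cc - 3) * x ≤ 1.4642 - 0.928 * x := by
    have : 0 ≤ (2 * cc - 3.464) * x := mul_nonneg (by linarith) x0
    nlinarith
  have a3 := mul_le_mul_of_nonneg_left a1 (show 0 ≤ 1.47 - 1.19 * x by linarith)
  linarith

/-- Generic weight. -/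
noncomputable def ww (A0 A1 B0 B1 x : ℝ) : ℝ := DD x / ((A0 + A1 * x) * (B0 + B1 * x))

/-- Logarithmic derivative of the generic weight. -/
noncomputable def ll (A0 A1 B0 B1 x : ℝ) : ℝ :=
  LD x - A1 / (A0 + A1 * x) - B1 / (B0 + B1 * x)

lemma hasDerivAt_lin (p q x : ℝ) : HasDerivAt (fun x => p + q * x) q x := by
  simpa using ((hasDerivAt_id x).const_mul q).const_add p

lemma hasDerivAt_DD {x : ℝ} (hx : x ∈ Icc (0 : ℝ) 1) : HasDerivAt DD (DD x * LD x) x := by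
  have h1 := (hasDerivAt_lin 1 (-(2 - cc)) x).fun_mul (hasDerivAt_lin 1 cc x)
  have e : DD = fun x => (1 + -(2 - cc) * x) * (1 + cc * x) := by
    funext x; unfold DD; ring
  rw [← e] at h1
  refine h1.congr_deriv ?_
  have g1 := (f1_pos hx).ne'
  have g2 : (1 + cc * x) ≠ 0 := by linarith [f2_pos hx]
  unfold DD LD
  field_simp
  ring

lemma hasDerivAt_ww {A0 A1 B0 B1 x : ℝ} (hx : x ∈ Icc (0 : ℝ) 1)
    (hA : 0 < A0 + A1 * x) (hB : 0 < B0 + B1 * x) :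
    HasDerivAt (ww A0 A1 B0 B1) (ww A0 A1 B0 B1 x * ll A0 A1 B0 B1 x) x := by
  have h1 := (hasDerivAt_DD hx).fun_div
    ((hasDerivAt_lin A0 A1 x).fun_mul (hasDerivAt_lin B0 B1 x)) (mul_pos hA hB).ne'
  have e : ww A0 A1 B0 B1 = fun x => DD x / ((A0 + A1 * x) * (B0 + B1 * x)) := rfl
  rw [← e] at h1
  refine h1.congr_deriv ?_
  unfold ww ll
  have hA' := hA.ne'
  have hB' := hB.ne'
  clear h1 e hA hB
  generalize A0 + A1 * x = p at *
  generalize B0 + B1 * x = q at *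
  field_simp
  ring

lemma ww_pos {A0 A1 B0 B1 x : ℝ} (hx : x ∈ Icc (0 : ℝ) 1)
    (hA : 0 < A0 + A1 * x) (hB : 0 < B0 + B1 * x) : 0 < ww A0 A1 B0 B1 x :=
  div_pos (DD_pos hx) (mul_pos hA hB)

/-- Linear data attached to a digit. -/
structure Lin where
  A0 : ℝ
  A1 : ℝ
  B0 : ℝ
  B1 : ℝ
  N0 : ℝ
  N1 : ℝ
  H0 : ℝ
  H1 : ℝ

noncomputable def linE (k e : ℝ) : Lin :=
  ⟨2 * k - 2 + cc, e, 2 * k + cc, e, 2 * k, e, 1, 0⟩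

noncomputable def linOp (k : ℝ) : Lin :=
  ⟨2 * k + (cc - 1), 2 * k - (3 - cc), (k + 1) + (cc - 1) / 2, (k + 1) - (3 - cc) / 2,
    k + 1, k, k, k - 1⟩

noncomputable def linOm (k : ℝ) : Lin :=
  ⟨2 * k - (3 - cc), 2 * k + (cc - 1), (k + 1) - (3 - cc) / 2, (k + 1) + (cc - 1) / 2,
    k, k + 1, k - 1, k⟩

noncomputable def lin (d : Digit) : Lin :=
  match d.s with
  | Par.e => linE d.a d.eps
  | Par.o => if d.eps = 1 then linOp d.a else linOm d.a

noncomputable def w (d : Digit) (x : ℝ) : ℝ :=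
  ww (lin d).A0 (lin d).A1 (lin d).B0 (lin d).B1 x

noncomputable def lam (d : Digit) (x : ℝ) : ℝ :=
  ll (lin d).A0 (lin d).A1 (lin d).B0 (lin d).B1 x

noncomputable def hN (d : Digit) (x : ℝ) : ℝ := (lin d).N0 + (lin d).N1 * x

lemma valid_cases {d : Digit} (hv : d.Valid) :
    (∃ k : ℤ, (1 : ℝ) ≤ k ∧ d = ⟨k, 1, Par.e⟩) ∨ (∃ k : ℤ, (2 : ℝ) ≤ k ∧ d = ⟨k, -1, Par.e⟩) ∨
    (∃ k : ℤ, (2 : ℝ) ≤ k ∧ d = ⟨k, 1, Par.o⟩) ∨ (∃ k : ℤ, (2 : ℝ) ≤ k ∧ d = ⟨k, -1, Par.o⟩) := by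
  obtain ⟨k, e, s⟩ := d
  cases s
  · rcases valid_e hv with ⟨h2, he | he⟩ | ⟨h2, he⟩
    · exact Or.inl ⟨k, by exact_mod_cast (by omega : (1 : ℤ) ≤ k), by rw [he]⟩
    · exact Or.inr (Or.inl ⟨k, by exact_mod_cast h2, by rw [he]⟩)
    · exact Or.inl ⟨k, by exact_mod_cast (by omega : (1 : ℤ) ≤ k), by rw [he]⟩
  · rcases valid_o hv with ⟨h2, he | he⟩
    · exact Or.inr (Or.inr (Or.inl ⟨k, by exact_mod_cast h2, by rw [he]⟩))
    · exact Or.inr (Or.inr (Or.inr ⟨k, by exact_mod_cast h2, by rw [he]⟩))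

lemma lin_ep (k : ℤ) : lin ⟨k, 1, Par.e⟩ = linE k 1 := by simp [lin]
lemma lin_em (k : ℤ) : lin ⟨k, -1, Par.e⟩ = linE k (-1) := by simp [lin]
lemma lin_op (k : ℤ) : lin ⟨k, 1, Par.o⟩ = linOp k := by simp [lin]
lemma lin_om (k : ℤ) : lin ⟨k, -1, Par.o⟩ = linOm k := by simp [lin]

lemma lin_pos {d : Digit} (hv : d.Valid) {x : ℝ} (hx : x ∈ Icc (0 : ℝ) 1) :
    0 < (lin d).A0 + (lin d).A1 * x ∧ 0 < (lin d).B0 + (lin d).B1 * x ∧ 0 < hN d x ∧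
    0 ≤ (lin d).H0 + (lin d).H1 * x ∧ (lin d).H0 + (lin d).H1 * x ≤ hN d x := by
  obtain ⟨x0, x1⟩ := hx
  have c1 := cc_gt; have c2 := cc_lt
  unfold hN
  rcases valid_cases hv with ⟨k, hk, rfl⟩ | ⟨k, hk, rfl⟩ | ⟨k, hk, rfl⟩ | ⟨k, hk, rfl⟩
  · rw [lin_ep]; simp only [linE]
    refine ⟨?_, ?_, ?_, ?_, ?_⟩ <;> linarith
  · rw [lin_em]; simp only [linE]
    refine ⟨?_, ?_, ?_, ?_, ?_⟩ <;> linarith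
  · rw [lin_op]; simp only [linOp]
    refine ⟨?_, ?_, ?_, ?_, ?_⟩ <;> nlinarith
  · rw [lin_om]; simp only [linOm]
    refine ⟨?_, ?_, ?_, ?_, ?_⟩ <;> nlinarith

lemma h_eq {d : Digit} (hv : d.Valid) (x : ℝ) :
    h d x = ((lin d).H0 + (lin d).H1 * x) / hN d x := by
  unfold hN
  rcases valid_cases hv with ⟨k, hk, rfl⟩ | ⟨k, hk, rfl⟩ | ⟨k, hk, rfl⟩ | ⟨k, hk, rfl⟩
  · rw [lin_ep]; simp [linE, h]
  · rw [lin_em]; simp [linE, h]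
  · rw [lin_op]; simp only [linOp, h, if_true]; ring_nf
  · rw [lin_om]; simp only [linOm, h]; rw [if_neg (by norm_num)]; ring_nf

lemma h_mem_Icc {d : Digit} (hv : d.Valid) {x : ℝ} (hx : x ∈ Icc (0 : ℝ) 1) :
    h d x ∈ Icc (0 : ℝ) 1 := by
  obtain ⟨_, _, h3, h4, h5⟩ := lin_pos hv hx
  rw [h_eq hv]
  exact ⟨div_nonneg h4 h3.le, (div_le_one h3).2 h5⟩

lemma hasDerivAt_h {d : Digit} (hv : d.Valid) {x : ℝ} (hx : x ∈ Icc (0 : ℝ) 1) :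
    HasDerivAt (h d) (-(d.eps : ℝ) / (hN d x) ^ 2) x := by
  obtain ⟨_, _, h3, h4, h5⟩ := lin_pos hv hx
  have e : h d = fun x => ((lin d).H0 + (lin d).H1 * x) / ((lin d).N0 + (lin d).N1 * x) := by
    funext y; exact h_eq hv y
  have h1 := (hasDerivAt_lin (lin d).H0 (lin d).H1 x).fun_div
    (hasDerivAt_lin (lin d).N0 (lin d).N1 x) h3.ne'
  rw [← e] at h1
  refine h1.congr_deriv ?_
  unfold hN
  congr 1
  rcases valid_cases hv with ⟨k, hk, rfl⟩ | ⟨k, hk, rfl⟩ | ⟨k, hk, rfl⟩ | ⟨k, hk, rfl⟩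
  · rw [lin_ep]; simp [linE]
  · rw [lin_em]; simp [linE]
  · rw [lin_op]; simp only [linOp]; push_cast; ring
  · rw [lin_om]; simp only [linOm]; push_cast; ring

lemma abs_h' {d : Digit} (hv : d.Valid) (x : ℝ) :
    |(-(d.eps : ℝ) / (hN d x) ^ 2)| = 1 / (hN d x) ^ 2 := by
  rw [abs_div, abs_neg, abs_of_nonneg (sq_nonneg (hN d x))]
  rcases valid_eps hv with h | h <;> simp [h]

lemma fdens_eq (x : ℝ) : fdens x = 2 / (Real.log (2 + Real.sqrt 3) * DD x) := by
  unfold fdens DD cc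
  rw [mul_assoc]

lemma num_ident {d : Digit} (hv : d.Valid) (x : ℝ) :
    (hN d x - (2 - cc) * ((lin d).H0 + (lin d).H1 * x)) *
      (hN d x + cc * ((lin d).H0 + (lin d).H1 * x)) =
    ((lin d).A0 + (lin d).A1 * x) * ((lin d).B0 + (lin d).B1 * x) := by
  have hc := cc_sq
  unfold hN
  rcases valid_cases hv with ⟨k, hk, rfl⟩ | ⟨k, hk, rfl⟩ | ⟨k, hk, rfl⟩ | ⟨k, hk, rfl⟩
  · rw [lin_ep]; simp only [linE]; ring
  · rw [lin_em]; simp only [linE]; ring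
  · rw [lin_op]; simp only [linOp]
    have e1 : ((k : ℝ) + 1 + k * x) - (2 - cc) * (k + (k - 1) * x) =
        (cc - 1) * ((k + 1) + (cc - 1) / 2 + ((k + 1) - (3 - cc) / 2) * x) := by
      linear_combination (-(1 + x) / 2) * hc
    have e2 : ((k : ℝ) + 1 + k * x) + cc * (k + (k - 1) * x) =
        (cc + 1) / 2 * (2 * k + (cc - 1) + (2 * k - (3 - cc)) * x) := by
      linear_combination (-(1 + x) / 2) * hc
    rw [e1, e2]
    linear_combination ((((k : ℝ) + 1) + (cc - 1) / 2 + ((k + 1) - (3 - cc) / 2) * x) *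
      (2 * k + (cc - 1) + (2 * k - (3 - cc)) * x) / 2) * hc
  · rw [lin_om]; simp only [linOm]
    have e1 : ((k : ℝ) + (k + 1) * x) - (2 - cc) * (k - 1 + k * x) =
        (cc - 1) * ((k + 1) - (3 - cc) / 2 + ((k + 1) + (cc - 1) / 2) * x) := by
      linear_combination (-(1 + x) / 2) * hc
    have e2 : ((k : ℝ) + (k + 1) * x) + cc * (k - 1 + k * x) =
        (cc + 1) / 2 * (2 * k - (3 - cc) + (2 * k + (cc - 1)) * x) := by
      linear_combination (-(1 + x) / 2) * hc
    rw [e1, e2]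
    linear_combination ((((k : ℝ) + 1) - (3 - cc) / 2 + ((k + 1) + (cc - 1) / 2) * x) *
      (2 * k - (3 - cc) + (2 * k + (cc - 1)) * x) / 2) * hc

lemma L_pos : 0 < Real.log (2 + Real.sqrt 3) := by
  apply Real.log_pos
  linarith [Real.sqrt_nonneg 3]

lemma jac {d : Digit} (hv : d.Valid) {x : ℝ} (hx : x ∈ Icc (0 : ℝ) 1) :
    1 / (hN d x) ^ 2 * fdens (h d x) = w d x * fdens x := by
  obtain ⟨hA, hB, h3, h4, h5⟩ := lin_pos hv hx
  have hD := DD_pos hx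
  have hL := L_pos
  have key : (hN d x) ^ 2 * DD (h d x) =
      ((lin d).A0 + (lin d).A1 * x) * ((lin d).B0 + (lin d).B1 * x) := by
    rw [← num_ident hv, h_eq hv]
    unfold DD
    field_simp
  have hD2 := DD_pos (h_mem_Icc hv hx)
  rw [fdens_eq, fdens_eq, w, ww, ← key]
  field_simp

lemma hasDerivAt_w {d : Digit} (hv : d.Valid) {x : ℝ} (hx : x ∈ Icc (0 : ℝ) 1) :
    HasDerivAt (w d) (w d x * lam d x) x := by
  obtain ⟨hA, hB, _⟩ := lin_pos hv hx
  exact hasDerivAt_ww hx hA hB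

lemma w_pos {d : Digit} (hv : d.Valid) {x : ℝ} (hx : x ∈ Icc (0 : ℝ) 1) : 0 < w d x := by
  obtain ⟨hA, hB, _⟩ := lin_pos hv hx
  exact ww_pos hx hA hB

set_option maxHeartbeats 2000000 in
/-- Pointwise contraction inequality. -/
lemma contr {d : Digit} (hv : d.Valid) {x : ℝ} (hx : x ∈ Icc (0 : ℝ) 1) :
    |lam d x| + 2.6 / (hN d x) ^ 2 ≤ 2.47 - 1.14 * x := by
  obtain ⟨hA, hB, hN0, _, _⟩ := lin_pos hv hx
  have l0 := LD_nonneg hx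
  have l1 := LD_le hx
  have c1 := cc_gt; have c2 := cc_lt
  have f1 := f1_pos hx
  have f2 := f2_pos hx
  obtain ⟨x0, x1⟩ := hx
  have habs : ∀ a b c : ℝ, a + b ≤ c → -a + b ≤ c → |a| + b ≤ c := by
    intro a b c h1 h2
    have : |a| ≤ c - b := abs_le.2 ⟨by linarith, by linarith⟩
    linarith
  unfold lam ll
  unfold hN at *
  rcases valid_cases hv with ⟨k, hk, rfl⟩ | ⟨k, hk, rfl⟩ | ⟨k, hk, rfl⟩ | ⟨k, hk, rfl⟩
  · rw [lin_ep] at *; simp only [linE] at *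
    have hn : 2.6 / (2 * (k : ℝ) + 1 * x) ^ 2 ≤ 0.65 := by
      rw [div_le_iff₀ (by positivity)]; nlinarith
    have p1 := div_pos one_pos hA
    have p2 := div_pos one_pos hB
    have q1 : 1 / (2 * (k : ℝ) - 2 + cc + 1 * x) ≤ 0.578 - 0.21 * x := by
      rw [div_le_iff₀ hA]
      have : 1.732 + x ≤ 2 * (k : ℝ) - 2 + cc + 1 * x := by linarith
      have := mul_le_mul_of_nonneg_left this (show 0 ≤ 0.578 - 0.21 * x by linarith)
      nlinarith
    have q2 : 1 / (2 * (k : ℝ) + cc + 1 * x) ≤ 0.268 := by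
      rw [div_le_iff₀ hB]; nlinarith
    apply habs <;> linarith
  · rw [lin_em] at *; simp only [linE] at *
    have g : 0 ≤ x * (1 - x) := mul_nonneg x0 (by linarith)
    have hn : 2.6 / (2 * (k : ℝ) + -1 * x) ^ 2 ≤ 0.1625 + 0.1265 * x := by
      rw [div_le_iff₀ (by positivity)]
      have : (4 - x) ^ 2 ≤ (2 * (k : ℝ) + -1 * x) ^ 2 := by
        apply pow_le_pow_left₀ <;> linarith
      have := mul_le_mul_of_nonneg_left this (show 0 ≤ 0.1625 + 0.1265 * x by linarith)
      nlinarith [mul_nonneg x0 g]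
    have q1 : 1 / (2 * (k : ℝ) - 2 + cc + -1 * x) ≤ 0.268 + 0.099 * x := by
      rw [div_le_iff₀ hA]
      have : 3.732 - x ≤ 2 * (k : ℝ) - 2 + cc + -1 * x := by linarith
      have := mul_le_mul_of_nonneg_left this (show 0 ≤ 0.268 + 0.099 * x by linarith)
      nlinarith
    have q2 : 1 / (2 * (k : ℝ) + cc + -1 * x) ≤ 0.1745 + 0.038 * x := by
      rw [div_le_iff₀ hB]
      have : 5.732 - x ≤ 2 * (k : ℝ) + cc + -1 * x := by linarith
      have := mul_le_mul_of_nonneg_left this (show 0 ≤ 0.1745 + 0.038 * x by linarith)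
      nlinarith
    have p1 := div_pos one_pos hA
    have p2 := div_pos one_pos hB
    rw [neg_div, neg_div]
    apply habs <;> linarith
  · rw [lin_op] at *; simp only [linOp] at *
    have hn : 2.6 / ((k : ℝ) + 1 + k * x) ^ 2 ≤ 0.289 := by
      have : 3 ≤ (k : ℝ) + 1 + k * x := by nlinarith
      rw [div_le_iff₀ (by positivity)]; nlinarith
    have p1 : 0 ≤ (2 * (k : ℝ) - (3 - cc)) / (2 * k + (cc - 1) + (2 * k - (3 - cc)) * x) :=
      div_nonneg (by linarith) hA.le
    have p2 : 0 ≤ ((k : ℝ) + 1 - (3 - cc) / 2) /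
        (k + 1 + (cc - 1) / 2 + (k + 1 - (3 - cc) / 2) * x) :=
      div_nonneg (by linarith) hB.le
    have q1 : (2 * (k : ℝ) - (3 - cc)) / (2 * k + (cc - 1) + (2 * k - (3 - cc)) * x)
        ≤ 1 - x / 2 := by
      rw [div_le_iff₀ hA]
      have e : 2 * (k : ℝ) + (cc - 1) = 2 * k - (3 - cc) + 2 := by ring
      rw [e]
      have : 0 ≤ 2 * (k : ℝ) - (3 - cc) := by linarith
      generalize 2 * (k : ℝ) - (3 - cc) = t at *
      nlinarith [mul_nonneg this (mul_nonneg x0 (sub_nonneg.2 x1))]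
    have q2 : ((k : ℝ) + 1 - (3 - cc) / 2) /
        (k + 1 + (cc - 1) / 2 + (k + 1 - (3 - cc) / 2) * x) ≤ 1 - x / 2 := by
      rw [div_le_iff₀ hB]
      have e : (k : ℝ) + 1 + (cc - 1) / 2 = k + 1 - (3 - cc) / 2 + 1 := by ring
      rw [e]
      have : 0 ≤ (k : ℝ) + 1 - (3 - cc) / 2 := by linarith
      generalize (k : ℝ) + 1 - (3 - cc) / 2 = t at *
      nlinarith [mul_nonneg this (mul_nonneg x0 (sub_nonneg.2 x1))]
    apply habs <;> linarith
  · rw [lin_om] at *; simp only [linOm] at *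
    have hNk : 2 + 3 * x ≤ (k : ℝ) + (k + 1) * x := by nlinarith
    have g : 0 ≤ x * (1 - x) := mul_nonneg x0 (by linarith)
    have hn : 2.6 / ((k : ℝ) + (k + 1) * x) ^ 2 ≤ 0.65 - 0.5 * x := by
      rw [div_le_iff₀ (by positivity)]
      have : (2 + 3 * x) ^ 2 ≤ ((k : ℝ) + (k + 1) * x) ^ 2 := by
        apply pow_le_pow_left₀ <;> linarith
      have := mul_le_mul_of_nonneg_left this (show 0 ≤ 0.65 - 0.5 * x by linarith)
      nlinarith [mul_nonneg x0 g]
    have p1 : 0 ≤ (2 * (k : ℝ) + (cc - 1)) / (2 * k - (3 - cc) + (2 * k + (cc - 1)) * x) :=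
      div_nonneg (by linarith) hA.le
    have p2 : 0 ≤ ((k : ℝ) + 1 + (cc - 1) / 2) /
        (k + 1 - (3 - cc) / 2 + (k + 1 + (cc - 1) / 2) * x) :=
      div_nonneg (by linarith) hB.le
    have q1 : (2 * (k : ℝ) + (cc - 1)) / (2 * k - (3 - cc) + (2 * k + (cc - 1)) * x)
        ≤ cc / (1 + cc * x) := by
      rw [div_le_div_iff₀ hA (by linarith)]
      have : 0 ≤ (cc - 1) * ((k : ℝ) - 2) := mul_nonneg (by linarith) (by linarith)
      nlinarith [cc_sq]
    have q2 : ((k : ℝ) + 1 + (cc - 1) / 2) /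
        (k + 1 - (3 - cc) / 2 + (k + 1 + (cc - 1) / 2) * x) ≤ 1.425 - 0.83 * x := by
      rw [div_le_iff₀ hB]
      have e : (k : ℝ) + 1 - (3 - cc) / 2 = k + 1 + (cc - 1) / 2 - 1 := by ring
      rw [e]
      have : 3.366 ≤ (k : ℝ) + 1 + (cc - 1) / 2 := by linarith
      generalize (k : ℝ) + 1 + (cc - 1) / 2 = t at *
      have q : 0 ≤ 0.425 + 0.595 * x - 0.83 * x ^ 2 := by nlinarith
      nlinarith [mul_nonneg (sub_nonneg.2 this) q]
    have q3 : (2 - cc) / (1 - (2 - cc) * x) ≤ 0.269 + 0.1 * x := by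
      rw [div_le_iff₀ f1]
      have : (2 - cc) * x ≤ 0.268 * x := by nlinarith
      nlinarith [mul_nonneg (show 0 ≤ 0.269 + 0.1 * x by linarith) (sub_nonneg.2 this)]
    have hLD : LD x = cc / (1 + cc * x) - (2 - cc) / (1 - (2 - cc) * x) := rfl
    apply habs
    · linarith
    · rw [hLD]; linarith

/-- The defect `1 - ∑_{a ≤ K} w`. -/
noncomputable def r (K x : ℝ) : ℝ :=
  ww (2 * (2 * K + cc)) 2 1 0 x + ww (2 * (2 * K + cc)) (-2) 1 0 x +
  (ww 2 2 ((K + 1) + (cc - 1) / 2) ((K + 1) - (3 - cc) / 2) x +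
   ww 2 2 ((K + 1) - (3 - cc) / 2) ((K + 1) + (cc - 1) / 2) x)

lemma S_succ_sum (n : ℕ) (F : Digit → ℝ) :
    ∑ d ∈ S (n + 1), F d = ∑ d ∈ S n, F d +
      (F ⟨n + 2, 1, Par.e⟩ + (F ⟨n + 2, -1, Par.e⟩ + (F ⟨n + 2, 1, Par.o⟩ +
        F ⟨n + 2, -1, Par.o⟩))) := by
  rw [S, Finset.sum_union]
  · congr 1
    rw [Finset.sum_insert (by simp), Finset.sum_insert (by simp), Finset.sum_insert (by simp),
      Finset.sum_singleton]
  · rw [Finset.disjoint_left]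
    intro d hd hd'
    have := ((mem_S n d).1 hd).2
    simp only [Finset.mem_insert, Finset.mem_singleton] at hd'
    rcases hd' with rfl | rfl | rfl | rfl <;> simp at this

lemma tele_e {p D : ℝ} (hp : 0 < p) :
    D / (p * (p + 2)) = D / (2 * p * (1 : ℝ)) - D / (2 * (p + 2) * (1 : ℝ)) := by
  field_simp
  ring

lemma tele_o {p D y : ℝ} (hp : 0 < p) (hy : 0 < y) :
    D / (2 * p * (p + y)) = D / (2 * y * p) - D / (2 * y * (p + y)) := by
  field_simp
  ring

lemma step_sum {K x : ℝ} (hK : 1 ≤ K) (hx : x ∈ Icc (0 : ℝ) 1) {k : ℤ} (hk : (k : ℝ) = K + 1) :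
    w ⟨k, 1, Par.e⟩ x + (w ⟨k, -1, Par.e⟩ x + (w ⟨k, 1, Par.o⟩ x + w ⟨k, -1, Par.o⟩ x)) =
    r K x - r (K + 1) x := by
  obtain ⟨x0, x1⟩ := hx
  have c1 := cc_gt; have c2 := cc_lt
  have e1 : w ⟨k, 1, Par.e⟩ x =
      ww (2 * (2 * K + cc)) 2 1 0 x - ww (2 * (2 * (K + 1) + cc)) 2 1 0 x := by
    simp only [w, lin_ep, linE, ww]
    have := @tele_e (2 * K + cc + x) (DD x) (by linarith)
    rw [hk]
    convert this using 2 <;> ring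
  have e2 : w ⟨k, -1, Par.e⟩ x =
      ww (2 * (2 * K + cc)) (-2) 1 0 x - ww (2 * (2 * (K + 1) + cc)) (-2) 1 0 x := by
    simp only [w, lin_em, linE, ww]
    have := @tele_e (2 * K + cc - x) (DD x) (by linarith)
    rw [hk]
    convert this using 2 <;> ring
  have e3 : w ⟨k, 1, Par.o⟩ x =
      ww 2 2 ((K + 1) + (cc - 1) / 2) ((K + 1) - (3 - cc) / 2) x -
      ww 2 2 ((K + 1 + 1) + (cc - 1) / 2) ((K + 1 + 1) - (3 - cc) / 2) x := by
    simp only [w, lin_op, linOp, ww]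
    have := @tele_o ((K + 1) + (cc - 1) / 2 + ((K + 1) - (3 - cc) / 2) * x) (DD x) (1 + x)
      (by nlinarith) (by linarith)
    rw [hk]
    convert this using 2 <;> ring
  have e4 : w ⟨k, -1, Par.o⟩ x =
      ww 2 2 ((K + 1) - (3 - cc) / 2) ((K + 1) + (cc - 1) / 2) x -
      ww 2 2 ((K + 1 + 1) - (3 - cc) / 2) ((K + 1 + 1) + (cc - 1) / 2) x := by
    simp only [w, lin_om, linOm, ww]
    have := @tele_o ((K + 1) - (3 - cc) / 2 + ((K + 1) + (cc - 1) / 2) * x) (DD x) (1 + x)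
      (by nlinarith) (by linarith)
    rw [hk]
    convert this using 2 <;> ring
  rw [e1, e2, e3, e4]
  unfold r
  ring

lemma base_sum {x : ℝ} (hx : x ∈ Icc (0 : ℝ) 1) : w ⟨1, 1, Par.e⟩ x = 1 - r 1 x := by
  have hD := DD_pos hx
  have f1 := f1_pos hx
  have f2 := f2_pos hx
  obtain ⟨x0, x1⟩ := hx
  have c1 := cc_gt; have c2 := cc_lt
  have hc := cc_sq
  have hp : 0 < cc + x := by linarith
  have hw : w ⟨1, 1, Par.e⟩ x = DD x / (2 * (cc + x)) - ww (2 * (2 * 1 + cc)) 2 1 0 x := by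
    simp only [w, lin_ep, linE, ww]
    have := @tele_e (cc + x) (DD x) (by linarith)
    push_cast
    convert this using 2 <;> ring
  have g2 : DD x / (2 * (cc + x)) + ww (2 * (2 * 1 + cc)) (-2) 1 0 x =
      DD x * ((cc - 1) / ((cc + x) * (1 - (2 - cc) * x))) := by
    simp only [ww]
    have e : 2 * (2 * 1 + cc) + -2 * x = 2 * (2 + cc) * (1 - (2 - cc) * x) := by
      linear_combination (-2 * x) * hc
    rw [e]
    have h2 : (2 + cc) ≠ 0 := by linarith
    have hp' := hp.ne'
    have hf := f1.ne'
    have key : (2 + cc) * (1 - (2 - cc) * x) + (cc + x) = 2 * (2 + cc) * (cc - 1) := by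
      linear_combination (x - 2) * hc
    generalize 1 - (2 - cc) * x = q at *
    generalize cc + x = p at *
    field_simp
    linear_combination key
  have g3 : ww 2 2 ((1 + 1) + (cc - 1) / 2) ((1 + 1) - (3 - cc) / 2) x +
      ww 2 2 ((1 + 1) - (3 - cc) / 2) ((1 + 1) + (cc - 1) / 2) x =
      DD x * (1 / ((cc + x) * (1 + cc * x))) := by
    simp only [ww]
    have e1 : ((1 + 1) + (cc - 1) / 2 + ((1 + 1) - (3 - cc) / 2) * x) =
        (1 + cc) / 2 * (cc + x) := by linear_combination (-1 / 2) * hc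
    have e2 : ((1 + 1) - (3 - cc) / 2 + ((1 + 1) + (cc - 1) / 2) * x) =
        (1 + cc) / 2 * (1 + cc * x) := by linear_combination (-x / 2) * hc
    rw [e1, e2]
    have h2 : (1 + cc) ≠ 0 := by linarith
    have hp' := hp.ne'
    have hf : (1 + cc * x) ≠ 0 := by linarith
    have hx' : (1 + x) ≠ 0 := by linarith
    have e3 : (2 + 2 * x) = 2 * (1 + x) := by ring
    have key : (cc + x) + (1 + cc * x) = (1 + cc) * (1 + x) := by ring
    rw [e3]
    generalize 1 + cc * x = q at *
    generalize cc + x = p at *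
    generalize 1 + x = y at *
    field_simp
    linear_combination key
  have g4 : DD x * ((cc - 1) / ((cc + x) * (1 - (2 - cc) * x))) +
      DD x * (1 / ((cc + x) * (1 + cc * x))) = 1 := by
    have key : (cc - 1) * (1 + cc * x) + (1 - (2 - cc) * x) = cc + x := by
      linear_combination x * hc
    have hf : (1 + cc * x) ≠ 0 := by linarith
    have hf1 := f1.ne'
    have hp' := hp.ne'
    unfold DD
    generalize 1 + cc * x = q at *
    generalize cc + x = p at *
    generalize 1 - (2 - cc) * x = y at *
    field_simp
    linear_combination key
  rw [hw]
  unfold r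
  linarith

lemma sum_w (n : ℕ) {x : ℝ} (hx : x ∈ Icc (0 : ℝ) 1) :
    ∑ d ∈ S n, w d x = 1 - r (n + 1) x := by
  induction n with
  | zero => simp only [S, Finset.sum_singleton]; rw [base_sum hx]; norm_num
  | succ n ih =>
    rw [S_succ_sum, ih, @step_sum (n + 1) x (by linarith [(Nat.cast_nonneg n : (0 : ℝ) ≤ n)]) hx
      (n + 2) (by push_cast; ring)]
    push_cast
    ring

/-- derivative of `r`. -/
noncomputable def r' (K x : ℝ) : ℝ :=
  ww (2 * (2 * K + cc)) 2 1 0 x * ll (2 * (2 * K + cc)) 2 1 0 x +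
  ww (2 * (2 * K + cc)) (-2) 1 0 x * ll (2 * (2 * K + cc)) (-2) 1 0 x +
  (ww 2 2 ((K + 1) + (cc - 1) / 2) ((K + 1) - (3 - cc) / 2) x *
    ll 2 2 ((K + 1) + (cc - 1) / 2) ((K + 1) - (3 - cc) / 2) x +
   ww 2 2 ((K + 1) - (3 - cc) / 2) ((K + 1) + (cc - 1) / 2) x *
    ll 2 2 ((K + 1) - (3 - cc) / 2) ((K + 1) + (cc - 1) / 2) x)

lemma r_den {K x : ℝ} (hK : 1 ≤ K) (hx : x ∈ Icc (0 : ℝ) 1) :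
    2 * K ≤ 2 * (2 * K + cc) + 2 * x ∧ 2 * K ≤ 2 * (2 * K + cc) + -2 * x ∧
    K ≤ ((K + 1) + (cc - 1) / 2) + ((K + 1) - (3 - cc) / 2) * x ∧
    K ≤ ((K + 1) - (3 - cc) / 2) + ((K + 1) + (cc - 1) / 2) * x := by
  obtain ⟨x0, x1⟩ := hx
  have c1 := cc_gt; have c2 := cc_lt
  refine ⟨?_, ?_, ?_, ?_⟩ <;> nlinarith

lemma hasDerivAt_r {K x : ℝ} (hK : 1 ≤ K) (hx : x ∈ Icc (0 : ℝ) 1) :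
    HasDerivAt (r K) (r' K x) x := by
  obtain ⟨d1, d2, d3, d4⟩ := r_den hK hx
  have x0 := hx.1
  exact (((hasDerivAt_ww hx (by linarith) (by norm_num)).add
    (hasDerivAt_ww hx (by linarith) (by norm_num))).add
    ((hasDerivAt_ww hx (by linarith) (by linarith)).add
    (hasDerivAt_ww hx (by linarith) (by linarith))))

lemma r_pos {K x : ℝ} (hK : 1 ≤ K) (hx : x ∈ Icc (0 : ℝ) 1) : 0 < r K x := by
  obtain ⟨d1, d2, d3, d4⟩ := r_den hK hx
  have x0 := hx.1
  exact add_pos (add_pos (ww_pos hx (by linarith) (by norm_num))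
    (ww_pos hx (by linarith) (by norm_num)))
    (add_pos (ww_pos hx (by linarith) (by linarith))
    (ww_pos hx (by linarith) (by linarith)))

lemma ww_le {A0 A1 B0 B1 x K : ℝ} (hK : 1 ≤ K) (hx : x ∈ Icc (0 : ℝ) 1)
    (h : 2 * K ≤ (A0 + A1 * x) * (B0 + B1 * x)) : ww A0 A1 B0 B1 x ≤ 1 / K := by
  unfold ww
  rw [div_le_div_iff₀ (by linarith) (by linarith)]
  nlinarith [DD_le hx]

lemma ll_le {A0 A1 B0 B1 x : ℝ} (hx : x ∈ Icc (0 : ℝ) 1)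
    (hA : 0 < A0 + A1 * x) (hB : 0 < B0 + B1 * x)
    (h1 : |A1| ≤ 1 * (A0 + A1 * x)) (h2 : |B1| ≤ 3 * (B0 + B1 * x)) :
    |ll A0 A1 B0 B1 x| ≤ 6 := by
  have l0 := LD_nonneg hx
  have l1 := LD_le hx
  have x0 := hx.1
  have e1 : |A1 / (A0 + A1 * x)| ≤ 1 := by
    rw [abs_div, abs_of_pos hA, div_le_iff₀ hA]; exact h1
  have e2 : |B1 / (B0 + B1 * x)| ≤ 3 := by
    rw [abs_div, abs_of_pos hB, div_le_iff₀ hB]; exact h2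
  rw [abs_le] at *
  unfold ll
  constructor <;> linarith [e1.1, e1.2, e2.1, e2.2]

lemma r'_le {K x : ℝ} (hK : 1 ≤ K) (hx : x ∈ Icc (0 : ℝ) 1) : |r' K x| ≤ 24 / K := by
  obtain ⟨d1, d2, d3, d4⟩ := r_den hK hx
  have x0 := hx.1
  have x1 := hx.2
  have c1 := cc_gt; have c2 := cc_lt
  have gen : ∀ A0 A1 B0 B1 : ℝ, 0 < A0 + A1 * x → 0 < B0 + B1 * x →
      |A1| ≤ 1 * (A0 + A1 * x) → |B1| ≤ 3 * (B0 + B1 * x) →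
      2 * K ≤ (A0 + A1 * x) * (B0 + B1 * x) →
      |ww A0 A1 B0 B1 x * ll A0 A1 B0 B1 x| ≤ 6 / K := by
    intro A0 A1 B0 B1 hA hB h1 h2 h3
    rw [abs_mul, abs_of_pos (ww_pos hx hA hB)]
    calc _ ≤ 1 / K * 6 := mul_le_mul (ww_le hK hx h3) (ll_le hx hA hB h1 h2) (abs_nonneg _)
            (by positivity)
      _ = 6 / K := by ring
  have b1 := gen (2 * (2 * K + cc)) 2 1 0 (by linarith) (by norm_num)
    (by rw [abs_of_pos (by norm_num)]; linarith) (by norm_num) (by linarith)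
  have b2 := gen (2 * (2 * K + cc)) (-2) 1 0 (by linarith) (by norm_num)
    (by rw [abs_of_neg (by norm_num)]; linarith) (by norm_num) (by linarith)
  have b3 := gen 2 2 ((K + 1) + (cc - 1) / 2) ((K + 1) - (3 - cc) / 2) (by linarith) (by linarith)
    (by rw [abs_of_pos (by norm_num)]; linarith)
    (by rw [abs_of_pos (by linarith)]; linarith) (by nlinarith)
  have b4 := gen 2 2 ((K + 1) - (3 - cc) / 2) ((K + 1) + (cc - 1) / 2) (by linarith) (by linarith)
    (by rw [abs_of_pos (by norm_num)]; linarith)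
    (by rw [abs_of_pos (by linarith)]; linarith) (by nlinarith)
  have : 24 / K = 6 / K + 6 / K + (6 / K + 6 / K) := by ring
  rw [this]
  unfold r'
  exact (abs_add_le _ _).trans (add_le_add ((abs_add_le _ _).trans (add_le_add b1 b2))
    ((abs_add_le _ _).trans (add_le_add b3 b4)))

lemma sum_w_lam (n : ℕ) {x : ℝ} (hx : x ∈ Icc (0 : ℝ) 1) :
    ∑ d ∈ S n, w d x * lam d x = - r' (n + 1) x := by
  have hK : (1 : ℝ) ≤ n + 1 := by linarith [(Nat.cast_nonneg n : (0 : ℝ) ≤ n)]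
  have h1 : HasDerivAt (fun y => ∑ d ∈ S n, w d y) (∑ d ∈ S n, w d x * lam d x) x :=
    HasDerivAt.fun_sum fun d hd => hasDerivAt_w ((mem_S n d).1 hd).1 hx
  have h2 : HasDerivAt (fun y => 1 - r (n + 1) y) (- r' (n + 1) x) x :=
    (hasDerivAt_r hK hx).const_sub 1
  have h3 : HasDerivWithinAt (fun y => ∑ d ∈ S n, w d y) (- r' (n + 1) x) (Icc 0 1) x :=
    h2.hasDerivWithinAt.congr (fun y hy => sum_w n hy) (sum_w n hx)
  exact UniqueDiffWithinAt.eq_deriv _ (uniqueDiffOn_Icc (by norm_num) x hx)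
    h1.hasDerivWithinAt h3

/-- weight for derivatives. -/
noncomputable def rho (x : ℝ) : ℝ := 1.3 - 0.6 * x

/-- Invariant class of functions. -/
def Good (M : ℝ) (g : ℝ → ℝ) : Prop :=
  (∀ x ∈ Icc (0 : ℝ) 1, 0 ≤ g x ∧ g x ≤ 1) ∧
  ∃ g' : ℝ → ℝ, ∀ x ∈ Icc (0 : ℝ) 1, HasDerivAt g (g' x) x ∧ |g' x| ≤ M * rho x

lemma Good.cont {M : ℝ} {g : ℝ → ℝ} (hg : Good M g) : ContinuousOn g (Icc 0 1) := by
  obtain ⟨_, g', h⟩ := hg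
  exact fun x hx => (h x hx).1.continuousAt.continuousWithinAt

lemma Good.mono {M : ℝ} {g : ℝ → ℝ} (hg : Good M g) {x y : ℝ} (hx : 0 ≤ x) (hxy : x ≤ y)
    (hy : y ≤ 1) : |g y - g x| ≤ M * ((1.3 * y - 0.3 * y ^ 2) - (1.3 * x - 0.3 * x ^ 2)) := by
  have hc := hg.cont
  obtain ⟨_, g', h⟩ := hg
  have hR : ∀ x : ℝ, HasDerivAt (fun x => M * (1.3 * x - 0.3 * x ^ 2)) (M * rho x) x := by
    intro x
    have := (((hasDerivAt_id x).const_mul 1.3).sub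
      (((hasDerivAt_id x).pow 2).const_mul 0.3)).const_mul M
    refine HasDerivAt.congr_deriv this ?_
    simp [rho]; left; ring
  have hcR : ContinuousOn (fun x => M * (1.3 * x - 0.3 * x ^ 2)) (Icc 0 1) := by fun_prop
  have m1 : MonotoneOn (fun x => M * (1.3 * x - 0.3 * x ^ 2) - g x) (Icc 0 1) := by
    apply monotoneOn_of_deriv_nonneg (convex_Icc 0 1) (hcR.sub hc)
    · intro x hx
      have hx' := interior_subset hx
      exact ((hR x).sub (h x hx').1).differentiableAt.differentiableWithinAt
    · intro x hx
      have hx' := interior_subset hx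
      have := ((hR x).sub (h x hx').1).deriv
      rw [this]
      have := (abs_le.1 (h x hx').2).2
      linarith
  have m2 : MonotoneOn (fun x => M * (1.3 * x - 0.3 * x ^ 2) + g x) (Icc 0 1) := by
    apply monotoneOn_of_deriv_nonneg (convex_Icc 0 1) (hcR.add hc)
    · intro x hx
      have hx' := interior_subset hx
      exact ((hR x).add (h x hx').1).differentiableAt.differentiableWithinAt
    · intro x hx
      have hx' := interior_subset hx
      have := ((hR x).add (h x hx').1).deriv
      rw [this]
      have := (abs_le.1 (h x hx').2).1
      linarith
  have i1 := m1 ⟨hx, hxy.trans hy⟩ ⟨hx.trans hxy, hy⟩ hxy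
  have i2 := m2 ⟨hx, hxy.trans hy⟩ ⟨hx.trans hxy, hy⟩ hxy
  simp only at i1 i2
  rw [abs_le]
  constructor <;> linarith

lemma Good.center {M : ℝ} {g : ℝ → ℝ} (hg : Good M g) {x : ℝ} (hx : x ∈ Icc (0 : ℝ) 1) :
    |g x - (g 0 + g 1) / 2| ≤ M / 2 := by
  have h1 := abs_le.1 (hg.mono le_rfl hx.1 hx.2)
  have h2 := abs_le.1 (hg.mono hx.1 hx.2 le_rfl)
  rw [abs_le]
  constructor <;> linarith [h1.1, h1.2, h2.1, h2.2]

/-- The transfer operator restricted to digits at most `n + 1`. -/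
noncomputable def PP (n : ℕ) (g : ℝ → ℝ) (x : ℝ) : ℝ := ∑ d ∈ S n, w d x * g (h d x)

lemma Good.PP {M : ℝ} {g : ℝ → ℝ} {n : ℕ} (hg : Good M g) (hM : 0 ≤ M)
    (hMn : 24 / (n + 1 : ℝ) ≤ 0.035 * M) : Good M (PP n g) := by
  have hcen := fun x hx => @Good.center M g hg x hx
  obtain ⟨hb, g', h⟩ := hg
  have hK : (1 : ℝ) ≤ n + 1 := by linarith [(Nat.cast_nonneg n : (0 : ℝ) ≤ n)]
  refine ⟨fun x hx => ⟨?_, ?_⟩, fun x => ∑ d ∈ S n, (w d x * lam d x * g (SCF.h d x) +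
      w d x * (g' (SCF.h d x) * (-(d.eps : ℝ) / (hN d x) ^ 2))), fun x hx => ⟨?_, ?_⟩⟩
  · apply Finset.sum_nonneg
    intro d hd
    have hv := ((mem_S n d).1 hd).1
    exact mul_nonneg (w_pos hv hx).le (hb _ (h_mem_Icc hv hx)).1
  · calc SCF.PP n g x ≤ ∑ d ∈ S n, w d x := by
          apply Finset.sum_le_sum
          intro d hd
          have hv := ((mem_S n d).1 hd).1
          exact mul_le_of_le_one_right (w_pos hv hx).le (hb _ (h_mem_Icc hv hx)).2
      _ ≤ 1 := by rw [sum_w n hx]; linarith [r_pos hK hx]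
  · apply HasDerivAt.fun_sum
    intro d hd
    have hv := ((mem_S n d).1 hd).1
    exact (hasDerivAt_w hv hx).fun_mul
      (HasDerivAt.comp x (h _ (h_mem_Icc hv hx)).1 (hasDerivAt_h hv hx))
  · set c := (g 0 + g 1) / 2 with hc
    have hc1 : |c| ≤ 1 := by
      have := hb 0 (by simp); have := hb 1 (by simp)
      rw [abs_le]; constructor <;> linarith
    have e : ∑ d ∈ S n, (w d x * lam d x * g (SCF.h d x) +
        w d x * (g' (SCF.h d x) * (-(d.eps : ℝ) / (hN d x) ^ 2))) =
        ∑ d ∈ S n, w d x * (lam d x * (g (SCF.h d x) - c) +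
        g' (SCF.h d x) * (-(d.eps : ℝ) / (hN d x) ^ 2)) + c * (- r' (n + 1) x) := by
      rw [← sum_w_lam n hx, Finset.mul_sum, ← Finset.sum_add_distrib]
      apply Finset.sum_congr rfl
      intro d _
      ring
    beta_reduce
    rw [e]
    have b1 : |∑ d ∈ S n, w d x * (lam d x * (g (SCF.h d x) - c) +
        g' (SCF.h d x) * (-(d.eps : ℝ) / (hN d x) ^ 2))| ≤
        ∑ d ∈ S n, w d x * (M * (0.95 * rho x)) := by
      apply (Finset.abs_sum_le_sum_abs _ _).trans
      apply Finset.sum_le_sum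
      intro d hd
      have hv := ((mem_S n d).1 hd).1
      have hh := h_mem_Icc hv hx
      rw [abs_mul, abs_of_pos (w_pos hv hx)]
      apply mul_le_mul_of_nonneg_left _ (w_pos hv hx).le
      have t1 : |lam d x * (g (SCF.h d x) - c)| ≤ |lam d x| * (M / 2) := by
        rw [abs_mul]
        exact mul_le_mul_of_nonneg_left (hcen _ hh) (abs_nonneg _)
      have hN0 := (lin_pos hv hx).2.2.1
      have t2 : |g' (SCF.h d x) * (-(d.eps : ℝ) / (hN d x) ^ 2)| ≤
          M * 1.3 * (1 / (hN d x) ^ 2) := by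
        rw [abs_mul, abs_h' hv]
        apply mul_le_mul_of_nonneg_right _ (by positivity)
        apply (h _ hh).2.trans
        apply mul_le_mul_of_nonneg_left _ hM
        unfold rho
        linarith [hh.1]
      have t3 := mul_le_mul_of_nonneg_left (contr hv hx) (show 0 ≤ M / 2 by linarith)
      apply (abs_add_le _ _).trans
      calc _ ≤ |lam d x| * (M / 2) + M * 1.3 * (1 / (hN d x) ^ 2) := add_le_add t1 t2
        _ = M / 2 * (|lam d x| + 2.6 / (hN d x) ^ 2) := by ring
        _ ≤ _ := t3
        _ = _ := by unfold rho; ring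
    have hrho : 0.7 ≤ rho x := by unfold rho; linarith [hx.2]
    have b2 : ∑ d ∈ S n, w d x * (M * (0.95 * rho x)) ≤ M * (0.95 * rho x) := by
      rw [← Finset.sum_mul, sum_w n hx]
      have : 0 ≤ r (n + 1) x * (M * (0.95 * rho x)) :=
        mul_nonneg (r_pos hK hx).le (mul_nonneg hM (by linarith))
      linarith
    have b3 : |c * (- r' (n + 1) x)| ≤ 24 / (n + 1 : ℝ) := by
      rw [abs_mul, abs_neg]
      calc _ ≤ 1 * (24 / (n + 1 : ℝ)) :=
            mul_le_mul hc1 (r'_le hK hx) (abs_nonneg _) (by norm_num)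
        _ = _ := one_mul _
    apply (abs_add_le _ _).trans
    have : M * 0.7 ≤ M * rho x := mul_le_mul_of_nonneg_left hrho hM
    linarith

lemma X0_sub : X0 ⊆ Icc (0 : ℝ) 1 := fun _ hx => ⟨hx.1.1.le, hx.1.2.le⟩

lemma X0_eq : X0 = Ioo (0 : ℝ) 1 \ Set.range ((↑) : ℚ → ℝ) := by
  ext x; rfl

lemma meas_X0 : MeasurableSet X0 := by
  rw [X0_eq]
  exact measurableSet_Ioo.diff (Set.countable_range _).measurableSet

lemma X0_ae : X0 =ᵐ[volume] (Ioo (0 : ℝ) 1 : Set ℝ) := by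
  rw [X0_eq]
  exact sdiff_null_ae_eq_self ((Set.countable_range _).measure_zero _)

lemma integral_X0 (F : ℝ → ℝ) : ∫ x in X0, F x = ∫ x in (0 : ℝ)..1, F x := by
  rw [setIntegral_congr_set X0_ae, intervalIntegral.integral_of_le zero_le_one,
    integral_Ioc_eq_integral_Ioo]

lemma AS_sub (K N : ℕ) : AS K N ⊆ Icc (0 : ℝ) 1 := fun _ hx => X0_sub hx.1

lemma meas_AS (n N : ℕ) : MeasurableSet (AS (n + 1) N) := by
  induction N with
  | zero => rw [AS_zero]; exact meas_X0
  | succ N ih =>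
    rw [AS_succ]
    refine Finset.measurableSet_biUnion _ fun d hd => ?_
    have hv := ((mem_S n d).1 hd).1
    refine ih.image_of_continuousOn_injOn ?_ ((injOn_h hv).mono fun x hx => hx.1)
    exact fun x hx => (hasDerivAt_h hv (AS_sub _ _ hx)).continuousAt.continuousWithinAt

lemma cont_DD : Continuous DD := by
  unfold DD; fun_prop

lemma cont_fdens : ContinuousOn fdens (Icc 0 1) := by
  have : ContinuousOn (fun x => 2 / (Real.log (2 + Real.sqrt 3) * DD x)) (Icc 0 1) := by
    refine continuousOn_const.div (continuousOn_const.mul cont_DD.continuousOn) ?_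
    intro x hx
    exact (mul_pos L_pos (DD_pos hx)).ne'
  exact this.congr fun x _ => fdens_eq x

lemma fdens_pos {x : ℝ} (hx : x ∈ Icc (0 : ℝ) 1) : 0 < fdens x := by
  rw [fdens_eq]
  have := mul_pos L_pos (DD_pos hx)
  positivity

lemma integ {F : ℝ → ℝ} (hF : ContinuousOn F (Icc 0 1)) {s : Set ℝ} (hs : s ⊆ Icc 0 1) :
    IntegrableOn F s :=
  (hF.integrableOn_compact isCompact_Icc).mono_set hs

lemma integ_mul {F : ℝ → ℝ} (hF : ContinuousOn F (Icc 0 1)) {s : Set ℝ} (hs : s ⊆ Icc 0 1) :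
    IntegrableOn (fun x => F x * fdens x) s :=
  integ (hF.mul cont_fdens) hs

lemma cont_h {d : Digit} (hv : d.Valid) : ContinuousOn (h d) (Icc 0 1) :=
  fun _ hx => (hasDerivAt_h hv hx).continuousAt.continuousWithinAt

lemma cont_w {d : Digit} (hv : d.Valid) : ContinuousOn (w d) (Icc 0 1) :=
  fun _ hx => (hasDerivAt_w hv hx).continuousAt.continuousWithinAt

lemma cont_term {d : Digit} (hv : d.Valid) {g : ℝ → ℝ} (hg : ContinuousOn g (Icc 0 1)) :
    ContinuousOn (fun x => w d x * g (h d x)) (Icc 0 1) :=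
  (cont_w hv).mul (hg.comp (cont_h hv) fun _ hx => h_mem_Icc hv hx)

lemma cont_PP (n : ℕ) {g : ℝ → ℝ} (hg : ContinuousOn g (Icc 0 1)) :
    ContinuousOn (PP n g) (Icc 0 1) := by
  unfold PP
  exact continuousOn_finsetSum _ fun d hd => cont_term ((mem_S n d).1 hd).1 hg

lemma chg (n N : ℕ) {g : ℝ → ℝ} (hg : ContinuousOn g (Icc 0 1)) :
    ∫ x in AS (n + 1) (N + 1), g x * fdens x = ∫ x in AS (n + 1) N, PP n g x * fdens x := by
  rw [AS_succ, integral_biUnion_finset]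
  · have : ∀ x, PP n g x * fdens x = ∑ d ∈ S n, w d x * g (h d x) * fdens x := by
      intro x; unfold PP; rw [Finset.sum_mul]
    simp only [this]
    rw [integral_finsetSum]
    · apply Finset.sum_congr rfl
      intro d hd
      have hv := ((mem_S n d).1 hd).1
      rw [integral_image_eq_integral_abs_deriv_smul (meas_AS n N)
        (fun x hx => (hasDerivAt_h hv (AS_sub _ _ hx)).hasDerivWithinAt)
        ((injOn_h hv).mono fun x hx => hx.1)]
      apply setIntegral_congr_fun (meas_AS n N)
      intro x hx
      have := jac hv (AS_sub _ _ hx)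
      simp only [smul_eq_mul]
      rw [abs_h' hv]
      linear_combination g (h d x) * this
    · intro d hd
      have hv := ((mem_S n d).1 hd).1
      exact integ ((cont_term hv hg).mul cont_fdens) (AS_sub _ _)
  · intro d hd
    have hv := ((mem_S n d).1 hd).1
    refine (meas_AS n N).image_of_continuousOn_injOn ?_ ((injOn_h hv).mono fun x hx => hx.1)
    exact (cont_h hv).mono (AS_sub _ _)
  · exact disj_h n N
  · intro d hd
    have hv := ((mem_S n d).1 hd).1
    apply integ (hg.mul cont_fdens)
    rintro _ ⟨x, hx, rfl⟩
    exact h_mem_Icc hv (AS_sub _ _ hx)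

lemma chg_iter (n N : ℕ) : ∀ {g : ℝ → ℝ}, ContinuousOn g (Icc 0 1) →
    ∫ x in AS (n + 1) N, g x * fdens x = ∫ x in X0, (PP n)^[N] g x * fdens x := by
  induction N with
  | zero => intro g _; rw [AS_zero]; rfl
  | succ N ih =>
    intro g hg
    rw [chg n N hg, ih (cont_PP n hg), Function.iterate_succ_apply]

lemma integral_fdens : ∫ x in X0, fdens x = 1 := by
  rw [integral_X0]
  have hL := L_pos
  have key : ∀ x ∈ uIcc (0 : ℝ) 1, HasDerivAt (fun x => (Real.log (1 + cc * x) -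
      Real.log (1 - (2 - cc) * x)) / Real.log (2 + Real.sqrt 3)) (fdens x) x := by
    intro x hx
    rw [uIcc_of_le zero_le_one] at hx
    have p1 := f1_pos hx
    have p2 := f2_pos hx
    have d2 : HasDerivAt (fun x => 1 + cc * x) cc x := hasDerivAt_lin _ _ _
    have d1 : HasDerivAt (fun x => 1 - (2 - cc) * x) (-(2 - cc)) x := by
      have := hasDerivAt_lin 1 (-(2 - cc)) x
      refine this.congr_of_eventuallyEq (Eventually.of_forall fun y => ?_)
      ring
    have := ((d2.log (by linarith)).fun_sub (d1.log p1.ne')).div_const (Real.log (2 + Real.sqrt 3))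
    refine this.congr_deriv ?_
    rw [fdens_eq]
    unfold DD
    have p2' : 1 + cc * x ≠ 0 := by linarith
    have p1' := p1.ne'
    have hL' := hL.ne'
    generalize Real.log (2 + Real.sqrt 3) = L at *
    have k : cc * (1 - (2 - cc) * x) + (2 - cc) * (1 + cc * x) = 2 := by ring
    generalize 1 + cc * x = q at *
    generalize 1 - (2 - cc) * x = p at *
    field_simp
    linear_combination k
  rw [intervalIntegral.integral_eq_sub_of_hasDerivAt key]
  · have h0 : Real.log (1 - (2 - cc) * 1) = Real.log (1 + cc) - Real.log (2 + cc) := by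
      have c1 := cc_gt
      rw [← Real.log_div (by linarith) (by linarith)]
      congr 1
      rw [eq_div_iff (by linarith)]
      linear_combination cc_sq
    have h1 : Real.log (2 + Real.sqrt 3) = Real.log (2 + cc) := rfl
    rw [h0, h1]
    rw [h1] at hL
    simp only [mul_one, mul_zero, add_zero, sub_zero, Real.log_one, zero_div, sub_sub_cancel]
    exact div_self hL.ne'
  · exact (cont_fdens.mono (by rw [uIcc_of_le zero_le_one])).intervalIntegrable

/-- The mass of the set where the first digit exceeds `n + 1`. -/
noncomputable def mm (n : ℕ) : ℝ := ∫ x in X0, r (n + 1) x * fdens x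

lemma cont_r {K : ℝ} (hK : 1 ≤ K) : ContinuousOn (r K) (Icc 0 1) :=
  fun _ hx => (hasDerivAt_r hK hx).continuousAt.continuousWithinAt

lemma one_le_n (n : ℕ) : (1 : ℝ) ≤ n + 1 := by
  linarith [(Nat.cast_nonneg n : (0 : ℝ) ≤ n)]

lemma mm_eq (n : ℕ) : ∫ x in AS (n + 1) 1, fdens x = 1 - mm n := by
  have := chg n 0 (g := fun _ => 1) continuousOn_const
  simp only [one_mul, zero_add] at this
  have e : 1 - mm n = (∫ x in X0, fdens x) - ∫ x in X0, r (n + 1) x * fdens x := by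
    rw [integral_fdens, mm]
  rw [e, this, AS_zero, ← integral_sub (integ cont_fdens X0_sub)
    (integ_mul (cont_r (one_le_n n)) X0_sub)]
  apply setIntegral_congr_fun meas_X0
  intro x hx
  have := sum_w n (X0_sub hx)
  simp only [PP, mul_one, this]
  ring

lemma mm_nonneg (n : ℕ) : 0 ≤ mm n :=
  setIntegral_nonneg meas_X0 fun _ hx =>
    mul_nonneg (r_pos (one_le_n n) (X0_sub hx)).le (fdens_pos (X0_sub hx)).le

lemma mm_le (n : ℕ) : mm n ≤ 1 := by
  have h1 : 0 ≤ ∫ x in AS (n + 1) 1, fdens x := setIntegral_nonneg (meas_AS n 1) fun _ hx =>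
    (fdens_pos (AS_sub _ _ hx)).le
  linarith [mm_eq n]

lemma mm_diff (n : ℕ) : ∫ x in X0 \ AS (n + 1) 1, fdens x = mm n := by
  rw [setIntegral_sdiff (meas_AS n 1) (integ cont_fdens X0_sub) (fun x hx => hx.1), integral_fdens,
    mm_eq]
  ring

lemma near' {s : Set ℝ} (hs : MeasurableSet s) (hs1 : s ⊆ Icc 0 1) {g : ℝ → ℝ} {M c : ℝ}
    (hg : ContinuousOn g (Icc 0 1)) (hc : ∀ x ∈ Icc (0 : ℝ) 1, |g x - c| ≤ M) :
    |(∫ x in s, g x * fdens x) - c * ∫ x in s, fdens x| ≤ M * ∫ x in s, fdens x := by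
  have i1 := integ_mul hg hs1
  have i2 := integ cont_fdens hs1
  rw [← integral_const_mul, ← integral_const_mul, ← integral_sub i1 (i2.const_mul c), abs_le,
    ← integral_neg]
  constructor
  · apply setIntegral_mono_on (i2.const_mul M).neg (i1.sub (i2.const_mul c)) hs
    intro x hx
    have := (abs_le.1 (hc x (hs1 hx))).1
    have f := fdens_pos (hs1 hx)
    simp only [Pi.sub_apply, Pi.neg_apply]
    nlinarith
  · apply setIntegral_mono_on (i1.sub (i2.const_mul c)) (i2.const_mul M) hs
    intro x hx
    have := (abs_le.1 (hc x (hs1 hx))).2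
    have f := fdens_pos (hs1 hx)
    simp only [Pi.sub_apply, Pi.neg_apply]
    nlinarith

/-- measure of `AS (n+1) N`. -/
noncomputable def uu (n N : ℕ) : ℝ := ∫ x in AS (n + 1) N, fdens x

/-- The Lipschitz constant. -/
noncomputable def MM (n : ℕ) : ℝ := 24 / 0.035 / (n + 1 : ℝ)

lemma good_iter (n N : ℕ) : Good (MM n) ((PP n)^[N] fun _ => 1) := by
  have hM : 0 ≤ MM n := by unfold MM; positivity
  induction N with
  | zero =>
    refine ⟨fun x _ => by simp, fun _ => 0, fun x hx => ⟨hasDerivAt_const _ _, ?_⟩⟩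
    simp only [abs_zero]
    apply mul_nonneg hM
    unfold rho
    linarith [hx.2]
  | succ N ih =>
    rw [Function.iterate_succ_apply']
    apply Good.PP ih hM
    unfold MM
    apply le_of_eq
    have := one_le_n n
    field_simp

lemma uu_eq (n N : ℕ) : uu n N = ∫ x in X0, (PP n)^[N] (fun _ => 1) x * fdens x := by
  rw [← chg_iter n N continuousOn_const]
  simp [uu]

lemma uu_succ (n N : ℕ) : |uu n (N + 1) - (1 - mm n) * uu n N| ≤ MM n * mm n := by
  have hg := good_iter n N
  have hc := hg.cont
  have e1 : uu n (N + 1) = ∫ x in AS (n + 1) 1, (PP n)^[N] (fun _ => 1) x * fdens x := by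
    rw [uu_eq, Function.iterate_succ_apply']
    have := chg n 0 hc
    rw [AS_zero] at this
    exact this.symm
  have e2 : ∫ x in X0 \ AS (n + 1) 1, (PP n)^[N] (fun _ => 1) x * fdens x =
      uu n N - uu n (N + 1) := by
    rw [setIntegral_sdiff (meas_AS n 1) (integ_mul hc X0_sub) (fun x hx => hx.1), e1,
      uu_eq]
  have n1 := near' meas_X0 X0_sub hc (fun x hx => hg.center hx)
  have n2 := near' (meas_X0.diff (meas_AS n 1)) (Set.sdiff_subset.trans X0_sub) hc
    (fun x hx => hg.center hx)
  rw [e2, mm_diff] at n2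
  rw [← uu_eq, integral_fdens, mul_one, mul_one] at n1
  have m0 := mm_nonneg n
  set c := ((PP n)^[N] (fun _ => 1) 0 + (PP n)^[N] (fun _ => 1) 1) / 2
  have n3 : |mm n * (uu n N - c)| ≤ mm n * (MM n / 2) := by
    rw [abs_mul, abs_of_nonneg m0]
    exact mul_le_mul_of_nonneg_left n1 m0
  rw [abs_le] at *
  constructor <;> nlinarith [n3.1, n3.2, n2.1, n2.2]

lemma uu_bound (n N : ℕ) : |uu n N - (1 - mm n) ^ N| ≤ N * (MM n * mm n) := by
  induction N with
  | zero => simp [uu, AS_zero, integral_fdens]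
  | succ N ih =>
    have h1 := uu_succ n N
    have m0 := mm_nonneg n
    have m1 := mm_le n
    have e : uu n (N + 1) - (1 - mm n) ^ (N + 1) = (uu n (N + 1) - (1 - mm n) * uu n N) +
      (1 - mm n) * (uu n N - (1 - mm n) ^ N) := by ring
    rw [e]
    apply (abs_add_le _ _).trans
    have : |(1 - mm n) * (uu n N - (1 - mm n) ^ N)| ≤ N * (MM n * mm n) := by
      rw [abs_mul, abs_of_nonneg (by linarith)]
      exact (mul_le_of_le_one_left (abs_nonneg _) (by linarith)).trans ih
    push_cast
    linarith

lemma lim_frac {p : ℝ} (hp : 0 < p) (q : ℝ) :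
    Tendsto (fun n : ℕ => ((n : ℝ) + 1) / (p * ((n : ℝ) + 1) + q)) atTop (𝓝 (1 / p)) := by
  have h1 : Tendsto (fun n : ℕ => 1 / (p + q * (1 / ((n : ℝ) + 1)))) atTop
      (𝓝 (1 / (p + q * 0))) := by
    refine Tendsto.div tendsto_const_nhds ?_ (by simpa using hp.ne')
    exact tendsto_const_nhds.add (tendsto_one_div_add_atTop_nhds_zero_nat.const_mul q)
  rw [mul_zero, add_zero] at h1
  refine h1.congr fun n => ?_
  have hn : ((n : ℝ) + 1) ≠ 0 := by positivity
  have e : p + q * (1 / ((n : ℝ) + 1)) = (p * ((n : ℝ) + 1) + q) / ((n : ℝ) + 1) := by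
    field_simp
  rw [e, one_div_div]

lemma lim_ww {A0 A1 B0 B1 : ℕ → ℝ} {x p q s D : ℝ} (hp : 0 < p)
    (hE : ∀ n : ℕ, (A0 n + A1 n * x) * (B0 n + B1 n * x) = s * (p * ((n : ℝ) + 1) + q))
    (hD : DD x / s = D) :
    Tendsto (fun n : ℕ => ((n : ℝ) + 1) * ww (A0 n) (A1 n) (B0 n) (B1 n) x) atTop
      (𝓝 (D * (1 / p))) := by
  refine ((lim_frac hp q).const_mul D).congr fun n => ?_
  unfold ww
  rw [hE, ← hD, div_mul_div_comm, mul_div_assoc', mul_comm (DD x)]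

lemma lim_r {x : ℝ} (hx : x ∈ Icc (0 : ℝ) 1) :
    Tendsto (fun n : ℕ => ((n : ℝ) + 1) * (r (n + 1) x * fdens x)) atTop
      (𝓝 (2 / Real.log (2 + Real.sqrt 3) * (1 / 2 + 1 / (1 + x) ^ 2))) := by
  have x0 := hx.1
  have l1 := @lim_ww (fun n => 2 * (2 * ((n : ℝ) + 1) + cc)) (fun _ => 2) (fun _ => 1) (fun _ => 0)
    x 4 (2 * cc + 2 * x) 1 _ (by norm_num) (fun n => by ring) rfl
  have l2 := @lim_ww (fun n => 2 * (2 * ((n : ℝ) + 1) + cc)) (fun _ => -2) (fun _ => 1) (fun _ => 0)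
    x 4 (2 * cc - 2 * x) 1 _ (by norm_num) (fun n => by ring) rfl
  have l3 := @lim_ww (fun _ => 2) (fun _ => 2) (fun n => ((n : ℝ) + 1 + 1) + (cc - 1) / 2)
    (fun n => ((n : ℝ) + 1 + 1) - (3 - cc) / 2)
    x (1 + x) (1 + (cc - 1) / 2 + (1 - (3 - cc) / 2) * x) (2 + 2 * x) _ (by linarith)
    (fun n => by ring) rfl
  have l4 := @lim_ww (fun _ => 2) (fun _ => 2) (fun n => ((n : ℝ) + 1 + 1) - (3 - cc) / 2)
    (fun n => ((n : ℝ) + 1 + 1) + (cc - 1) / 2)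
    x (1 + x) (1 - (3 - cc) / 2 + (1 + (cc - 1) / 2) * x) (2 + 2 * x) _ (by linarith)
    (fun n => by ring) rfl
  have l := ((l1.add l2).add (l3.add l4)).mul_const (fdens x)
  have e : (DD x / 1 * (1 / 4) + DD x / 1 * (1 / 4) + (DD x / (2 + 2 * x) * (1 / (1 + x)) +
      DD x / (2 + 2 * x) * (1 / (1 + x)))) * fdens x =
      2 / Real.log (2 + Real.sqrt 3) * (1 / 2 + 1 / (1 + x) ^ 2) := by
    rw [fdens_eq]
    have hD := (DD_pos hx).ne'
    have hL := L_pos.ne'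
    have h1 : 1 + x ≠ 0 := by linarith
    have h2 : 2 + 2 * x = 2 * (1 + x) := by ring
    rw [h2]
    generalize Real.log (2 + Real.sqrt 3) = L at *
    generalize DD x = D at *
    generalize 1 + x = y at *
    field_simp
    ring
  rw [e] at l
  refine l.congr fun n => ?_
  unfold r
  ring

lemma r_le {K x : ℝ} (hK : 1 ≤ K) (hx : x ∈ Icc (0 : ℝ) 1) : K * r K x ≤ 4 := by
  obtain ⟨d1, d2, d3, d4⟩ := r_den hK hx
  have x0 := hx.1
  have b1 := @ww_le (2 * (2 * K + cc)) 2 1 0 x K hK hx (by linarith)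
  have b2 := @ww_le (2 * (2 * K + cc)) (-2) 1 0 x K hK hx (by linarith)
  have b3 := @ww_le 2 2 ((K + 1) + (cc - 1) / 2) ((K + 1) - (3 - cc) / 2) x K hK hx (by nlinarith)
  have b4 := @ww_le 2 2 ((K + 1) - (3 - cc) / 2) ((K + 1) + (cc - 1) / 2) x K hK hx (by nlinarith)
  have : r K x ≤ 4 / K := by
    have : 4 / K = 1 / K + 1 / K + (1 / K + 1 / K) := by ring
    rw [this]
    unfold r
    linarith
  rw [le_div_iff₀ (by linarith)] at this
  linarith

lemma lim_int : ∫ x in (0 : ℝ)..1, 2 / Real.log (2 + Real.sqrt 3) * (1 / 2 + 1 / (1 + x) ^ 2) =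
    2 / Real.log (2 + Real.sqrt 3) := by
  rw [intervalIntegral.integral_const_mul]
  have key : ∀ x ∈ uIcc (0 : ℝ) 1, HasDerivAt (fun x : ℝ => x / 2 - 1 / (1 + x))
      (1 / 2 + 1 / (1 + x) ^ 2) x := by
    intro x hx
    rw [uIcc_of_le zero_le_one] at hx
    have x0 := hx.1
    have h1 : 1 + x ≠ 0 := by linarith
    have := ((hasDerivAt_id x).div_const 2).fun_sub
      (((hasDerivAt_const x (1 : ℝ)).fun_div ((hasDerivAt_id x).const_add 1) h1))
    refine this.congr_deriv ?_
    simp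
    ring
  rw [intervalIntegral.integral_eq_sub_of_hasDerivAt key]
  · norm_num
  · apply ContinuousOn.intervalIntegrable
    rw [uIcc_of_le zero_le_one]
    refine continuousOn_const.add (continuousOn_const.div (by fun_prop) ?_)
    intro x hx
    have x0 := hx.1
    positivity

lemma mm_lim : Tendsto (fun n : ℕ => ((n : ℝ) + 1) * mm n) atTop
    (𝓝 (2 / Real.log (2 + Real.sqrt 3))) := by
  rw [← lim_int]
  have hI : uIoc (0 : ℝ) 1 ⊆ Icc 0 1 := by
    rw [uIoc_of_le zero_le_one]; exact Ioc_subset_Icc_self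
  have : ∀ n : ℕ, ((n : ℝ) + 1) * mm n =
      ∫ x in (0 : ℝ)..1, ((n : ℝ) + 1) * (r (n + 1) x * fdens x) := by
    intro n
    rw [intervalIntegral.integral_const_mul, mm, integral_X0]
  simp only [this]
  apply intervalIntegral.tendsto_integral_filter_of_dominated_convergence (fun x => 4 * fdens x)
  · refine Eventually.of_forall fun n => ?_
    exact ((integ_mul (cont_r (one_le_n n)) hI).const_mul _).aestronglyMeasurable
  · refine Eventually.of_forall fun n => Eventually.of_forall fun x hx => ?_
    have f := fdens_pos (hI hx)
    have rp := r_pos (one_le_n n) (hI hx)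
    have := r_le (one_le_n n) (hI hx)
    have n1 := one_le_n n
    rw [Real.norm_of_nonneg (by positivity), ← mul_assoc]
    exact mul_le_mul_of_nonneg_right this f.le
  · apply ContinuousOn.intervalIntegrable
    rw [uIcc_of_le zero_le_one]
    exact continuousOn_const.mul cont_fdens
  · exact Eventually.of_forall fun x hx => lim_r (hI hx)

lemma mu_AS (n N : ℕ) : mu (AS (n + 1) N) = ENNReal.ofReal (uu n N) := by
  rw [mu, withDensity_apply _ (meas_AS n N), Measure.restrict_restrict (meas_AS n N),
    inter_eq_left.2 (fun x hx => hx.1.1), uu, ofReal_integral_eq_lintegral_ofReal]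
  · exact integ cont_fdens (AS_sub _ _)
  · filter_upwards [ae_restrict_mem (meas_AS n N)] with x hx
    exact (fdens_pos (AS_sub _ _ hx)).le

/-- Galambos-type extreme value theorem for the SCF digits with
respect to the invariant measure μ. -/
theorem scf_extreme_value_theorem :
    ∀ y : ℝ, 0 < y →
      Filter.Tendsto
        (fun N : ℕ =>
          mu {x : ℝ | x ∈ Set.Ioo (0 : ℝ) 1 ∧ Irrational x ∧
            ∀ n : ℕ, 1 ≤ n → n ≤ N →
              (a n x : ℝ) ≤ 2 * N * y / Real.log (2 + Real.sqrt 3)})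
        Filter.atTop (nhds (ENNReal.ofReal (Real.exp (-1 / y)))) := by
  intro y hy
  have hL := L_pos
  have hab : 0 < 2 * y / Real.log (2 + Real.sqrt 3) := by positivity
  have ht : ∀ N : ℕ, 2 * N * y / Real.log (2 + Real.sqrt 3) =
      2 * y / Real.log (2 + Real.sqrt 3) * (N : ℝ) := fun N => by ring
  simp only [ht]
  set al := 2 * y / Real.log (2 + Real.sqrt 3) with hal
  -- the truncation level
  set k : ℕ → ℕ := fun N => ⌊al * (N : ℝ)⌋₊ - 1 with hk
  have hfl : Tendsto (fun N : ℕ => ⌊al * (N : ℝ)⌋₊) atTop atTop :=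
    tendsto_nat_floor_atTop.comp (tendsto_natCast_atTop_atTop.const_mul_atTop hab)
  have hk1 : ∀ᶠ N : ℕ in atTop, k N + 1 = ⌊al * (N : ℝ)⌋₊ := by
    filter_upwards [hfl.eventually_ge_atTop 1] with N hN
    simp only [hk]
    omega
  have hkt : Tendsto k atTop atTop := (tendsto_sub_atTop_nat 1).comp hfl
  have hratio : Tendsto (fun N : ℕ => (N : ℝ) / ((k N : ℝ) + 1)) atTop (𝓝 al⁻¹) := by
    have h1 := ((tendsto_nat_floor_mul_div_atTop hab.le).comp
      (tendsto_natCast_atTop_atTop (R := ℝ))).inv₀ hab.ne'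
    refine h1.congr' ?_
    filter_upwards [hk1] with N hN
    have : ((k N : ℝ) + 1) = (⌊al * (N : ℝ)⌋₊ : ℝ) := by exact_mod_cast hN
    rw [this]
    simp
  have hNm : Tendsto (fun N : ℕ => (N : ℝ) * mm (k N)) atTop (𝓝 (1 / y)) := by
    have h1 := hratio.mul (mm_lim.comp hkt)
    have e : al⁻¹ * (2 / Real.log (2 + Real.sqrt 3)) = 1 / y := by
      rw [hal]; field_simp
    rw [e] at h1
    refine h1.congr fun N => ?_
    have : ((k N : ℝ) + 1) ≠ 0 := by positivity
    simp only [Function.comp]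
    field_simp
  have hpow : Tendsto (fun N : ℕ => (1 - mm (k N)) ^ N) atTop (𝓝 (Real.exp (-1 / y))) := by
    have h1 := Real.tendsto_one_add_pow_exp_of_tendsto (g := fun N => - mm (k N)) (t := -1 / y)
      (by
        have := hNm.neg
        have e : -(1 / y) = -1 / y := by ring
        rw [e] at this
        exact this.congr fun N => by ring)
    exact h1.congr fun N => by ring
  have hMM : Tendsto (fun N : ℕ => MM (k N)) atTop (𝓝 0) := by
    have h1 := (tendsto_one_div_add_atTop_nhds_zero_nat (𝕜 := ℝ)).const_mul (24 / 0.035)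
    rw [mul_zero] at h1
    refine (h1.comp hkt).congr fun N => ?_
    simp only [Function.comp, MM]
    ring
  have herr : Tendsto (fun N : ℕ => (N : ℝ) * (MM (k N) * mm (k N))) atTop (𝓝 0) := by
    have h1 := hMM.mul hNm
    rw [zero_mul] at h1
    exact h1.congr fun N => by ring
  have hu : Tendsto (fun N : ℕ => uu (k N) N) atTop (𝓝 (Real.exp (-1 / y))) := by
    have h1 : Tendsto (fun N : ℕ => uu (k N) N - (1 - mm (k N)) ^ N) atTop (𝓝 0) :=
      squeeze_zero_norm (fun N => uu_bound (k N) N) herr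
    have h2 := h1.add hpow
    rw [zero_add] at h2
    exact h2.congr fun N => by ring
  refine (ENNReal.tendsto_ofReal hu).congr' ?_
  filter_upwards [hk1] with N hN
  rw [← mu_AS, target_set_eq (k N + 1) N]
  rw [hN]
  exact (Int.natCast_floor_eq_floor (by positivity)).symm

end SCF
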